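/- arXiv:2605.19517 — 3 statements merged into one kernel-verified Lean document; each statement's English description precedes it below -/
import Mathlib

section
/- Let p be a prime with p ≡ 1 (mod 4) and n = (p−1)/2. Then for every real number ρ, the determinant of the n×n real matrix with (j,k) entry χ(j−k+1) + ρ·χ(k) (0 ≤ j,k ≤ n−1) equals L·((B − A) + (B − A − 1)·ρ). -/
open Complex Matrix BigOperators Finset

lemma lag_sum {n : ℕ} (y : Fin n → ℂ) (hy : Function.Injective y) (t : ℂ) (ht : ∀ l, t ≠ y l)
    (k : ℕ) (hk : k < n) :
    ∑ l, (∏ i, (t - y i)) * (Lagrange.nodalWeight univ y l * (t - y l)⁻¹) * y l ^ k = t ^ k := by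
  have h := Lagrange.eq_interpolate (s := (univ : Finset (Fin n))) (v := y)
    (f := (Polynomial.X ^ k : Polynomial ℂ)) hy.injOn (by
      rw [Polynomial.degree_X_pow]; simpa using hk)
  have h2 := congrArg (Polynomial.eval t) h
  rw [Lagrange.interpolate_apply, Polynomial.eval_finsetSum] at h2
  simp only [Polynomial.eval_mul, Polynomial.eval_pow, Polynomial.eval_X, Polynomial.eval_C] at h2
  rw [h2]
  refine Finset.sum_congr rfl fun l _ => ?_
  rw [Lagrange.eval_basis_not_at_node (mem_univ l) (ht l), Lagrange.eval_nodal]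
  ring

lemma prod_offdiag_pow {n : ℕ} (x : Fin n → ℂ) :
    ∏ i, ∏ j ∈ univ.erase i, (x i * x j) = (∏ i, x i) ^ (2 * (n - 1)) := by
  have h1 : ∏ i : Fin n, ∏ j ∈ univ.erase i, x i = (∏ i, x i) ^ (n - 1) := by
    simp [Finset.prod_const, Finset.prod_pow]
  have h2 : ∏ i : Fin n, ∏ j ∈ univ.erase i, x j = (∏ i, x i) ^ (n - 1) := by
    rw [← h1]
    refine Finset.prod_comm' ?_
    intro i j
    simp [eq_comm]
  simp only [Finset.prod_mul_distrib]
  rw [h1, h2, two_mul, pow_add]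

lemma prod_Ioi_pow {n : ℕ} (x : Fin n → ℂ) :
    ∏ i, ∏ j ∈ Ioi i, (x i * x j) = (∏ i, x i) ^ (n - 1) := by
  simp only [Finset.prod_mul_distrib]
  have h2 : ∏ i : Fin n, ∏ j ∈ Ioi i, x j = ∏ j, ∏ i ∈ Iio j, x j := by
    refine Finset.prod_comm' ?_
    intro i j; simp
  rw [h2, ← Finset.prod_mul_distrib, ← Finset.prod_pow]
  refine Finset.prod_congr rfl fun i _ => ?_
  simp only [Finset.prod_const, ← pow_add, Fin.card_Ioi, Fin.card_Iio]
  congr 1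
  omega

lemma prod_offdiag_split {n : ℕ} (f : Fin n → Fin n → ℂ) :
    ∏ i, ∏ j ∈ univ.erase i, f i j = ∏ i, ∏ j ∈ Ioi i, (f i j * f j i) := by
  simp only [Finset.prod_mul_distrib]
  have h2 : ∏ i : Fin n, ∏ j ∈ Ioi i, f j i = ∏ j, ∏ i ∈ Iio j, f j i := by
    refine Finset.prod_comm' ?_
    intro i j; simp
  rw [h2, ← Finset.prod_mul_distrib]
  refine Finset.prod_congr rfl fun i _ => ?_
  rw [← Finset.prod_union]
  · congr 1
    ext j
    simp only [mem_erase, mem_univ, mem_union, mem_Ioi, mem_Iio, and_true]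
    exact ⟨fun h => (lt_or_gt_of_ne h).symm, fun h => by rcases h with h | h; exacts [h.ne', h.ne]⟩
  · rw [Finset.disjoint_left]
    intro j hj hj'
    simp at hj hj'
    omega

lemma vand_sq {n : ℕ} (hn : Even n) (y : Fin n → ℂ) :
    (vandermonde y).det ^ 2 = (-1) ^ (n / 2) * ∏ i, ∏ j ∈ univ.erase i, (y i - y j) := by
  rw [prod_offdiag_split, det_vandermonde, ← Finset.prod_pow]
  simp only [← Finset.prod_pow]
  have h : ∀ i : Fin n, ∏ j ∈ Ioi i, ((y i - y j) * (y j - y i))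
     = (-1) ^ (n - 1 - (i : ℕ)) * ∏ j ∈ Ioi i, (y j - y i) ^ 2 := by
    intro i
    rw [← Fin.card_Ioi, ← Finset.prod_const, ← Finset.prod_mul_distrib]
    exact Finset.prod_congr rfl fun j _ => by ring
  simp only [h]
  rw [Finset.prod_mul_distrib, ← mul_assoc, Finset.prod_pow_eq_pow_sum]
  have h3 : ∑ i : Fin n, (n - 1 - (i : ℕ)) = n * (n - 1) / 2 := by
    rw [Fin.sum_univ_eq_sum_range (fun i => n - 1 - i), Finset.sum_range_reflect (fun i => i),
      Finset.sum_range_id]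
  rw [h3, ← pow_add]
  obtain ⟨m, rfl⟩ := hn
  have : (m + m) / 2 + (m + m) * (m + m - 1) / 2 = 2 * (m * m) := by
    have e1 : (m + m) * (m + m - 1) / 2 = m * (m + m - 1) := by
      rw [← two_mul, mul_assoc, Nat.mul_div_cancel_left _ (by norm_num)]
    rw [e1]
    rcases m with _ | m
    · simp
    · have : (m + 1 + (m + 1)) / 2 = m + 1 := by omega
      rw [this]
      have : m + 1 + (m + 1) - 1 = 2 * m + 1 := by omega
      rw [this]; ring
  rw [this, pow_mul]; simp

lemma prod_nodalWeight {n : ℕ} (y : Fin n → ℂ) :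
    ∏ l, Lagrange.nodalWeight univ y l = (∏ i, ∏ j ∈ univ.erase i, (y i - y j))⁻¹ := by
  simp [Lagrange.nodalWeight, Finset.prod_inv_distrib]

lemma cauchy_gen {n : ℕ} (a b : Fin n → ℂ) (hb : Function.Injective b) (hab : ∀ i j, a i ≠ b j) :
    (Matrix.of fun i j : Fin n => (a i - b j)⁻¹).det * (∏ i, ∏ k, (a i - b k))
      * (∏ j, Lagrange.nodalWeight univ b j) * (vandermonde b).det = (vandermonde a).det := by
  have : vandermonde a = diagonal (fun i => ∏ k, (a i - b k)) *
      (Matrix.of fun i j : Fin n => (a i - b j)⁻¹) *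
      diagonal (Lagrange.nodalWeight univ b) * vandermonde b := by
    ext i k
    rw [Matrix.mul_apply]
    simp only [Matrix.mul_diagonal, Matrix.diagonal_mul, vandermonde_apply, Matrix.of_apply]
    rw [← lag_sum b hb (a i) (hab i) k k.2]
    exact Finset.sum_congr rfl fun l _ => by ring
  rw [this]
  simp only [det_mul, det_diagonal]
  ring

lemma cauchy_det {n : ℕ} (x : Fin n → ℂ) (hx : Function.Injective x) (h0 : ∀ i, x i ≠ 0)
    (h1 : ∀ i j, 1 + x i * x j ≠ 0) :
    (Matrix.of fun i j : Fin n => (1 + x i * x j)⁻¹).det =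
      (∏ i, ∏ j ∈ univ.erase i, (x i - x j)) / ∏ i, ∏ j, (1 + x i * x j) := by
  set b : Fin n → ℂ := fun i => - (x i)⁻¹ with hb
  have hbi : Function.Injective b := by
    intro i j h
    simp [hb] at h
    exact hx h
  have hd : ∀ i j, x i - b j = (1 + x i * x j) * (x j)⁻¹ := by
    intro i j; simp only [hb]; field_simp [h0 j]; ring
  have hab : ∀ i j, x i ≠ b j := by
    intro i j h
    have := hd i j
    rw [sub_eq_zero.2 h] at this
    exact mul_ne_zero (h1 i j) (inv_ne_zero (h0 j)) this.symm
  have hg := cauchy_gen x b hbi hab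
  have hX : ∏ i, x i ≠ 0 := Finset.prod_ne_zero_iff.2 fun i _ => h0 i
  have e1 : (Matrix.of fun i j : Fin n => (x i - b j)⁻¹).det
      = (∏ i, x i) * (Matrix.of fun i j : Fin n => (1 + x i * x j)⁻¹).det := by
    rw [← det_diagonal, mul_comm, ← det_mul]
    congr 1
    ext i j
    simp only [Matrix.mul_diagonal, Matrix.of_apply, hd]
    rw [mul_inv, inv_inv]
  have e2 : ∏ i, ∏ k, (x i - b k) = (∏ i, ∏ k, (1 + x i * x k)) * ((∏ i, x i)⁻¹) ^ n := by
    simp only [hd, Finset.prod_mul_distrib]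
    simp
  have e3 : ∏ j, Lagrange.nodalWeight univ b j =
      (∏ i, ∏ j ∈ univ.erase i, (x i - x j))⁻¹ * (∏ i, x i) ^ (2 * (n - 1)) := by
    rw [prod_nodalWeight, ← prod_offdiag_pow, ← Finset.prod_inv_distrib, ← Finset.prod_inv_distrib,
      ← Finset.prod_mul_distrib]
    refine Finset.prod_congr rfl fun i _ => ?_
    rw [← Finset.prod_inv_distrib, ← Finset.prod_inv_distrib, ← Finset.prod_mul_distrib]
    refine Finset.prod_congr rfl fun j hj => ?_
    have : b i - b j = (x i - x j) * (x i * x j)⁻¹ := by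
      simp only [hb]; field_simp [h0 i, h0 j]; ring
    rw [this, mul_inv, inv_inv]
  have e4 : (vandermonde b).det * (∏ i, x i) ^ (n - 1) = (vandermonde x).det := by
    rw [← prod_Ioi_pow, det_vandermonde, det_vandermonde, ← Finset.prod_mul_distrib]
    refine Finset.prod_congr rfl fun i _ => ?_
    rw [← Finset.prod_mul_distrib]
    refine Finset.prod_congr rfl fun j hj => ?_
    simp only [hb]; field_simp [h0 i, h0 j]; ring
  have hVx : (vandermonde x).det ≠ 0 := det_vandermonde_ne_zero_iff.2 hx
  have hVb : (vandermonde b).det ≠ 0 := det_vandermonde_ne_zero_iff.2 hbi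
  have hO : ∏ i, ∏ j ∈ univ.erase i, (x i - x j) ≠ 0 := by
    refine Finset.prod_ne_zero_iff.2 fun i _ => Finset.prod_ne_zero_iff.2 fun j hj => ?_
    rw [sub_ne_zero]; intro h; exact (Finset.ne_of_mem_erase hj) (hx h).symm
  have hP : ∏ i, ∏ j, (1 + x i * x j) ≠ 0 :=
    Finset.prod_ne_zero_iff.2 fun i _ => Finset.prod_ne_zero_iff.2 fun j _ => h1 i j
  rw [e1, e2, e3, ← e4] at hg
  rcases n with _ | n
  · simp
  have e5 : (∏ i, x i) * ((∏ i, x i)⁻¹) ^ (n + 1) * (∏ i, x i) ^ (2 * (n + 1 - 1))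
      = (∏ i, x i) ^ (n + 1 - 1) := by
    simp only [Nat.add_sub_cancel, inv_pow]
    field_simp
    ring
  rw [eq_div_iff hP]
  have hX2 : (∏ i, x i) ^ (n + 1 - 1) ≠ 0 := pow_ne_zero _ hX
  apply mul_right_cancel₀ (mul_ne_zero hVb hX2)
  conv_rhs => rw [← hg]
  rw [← e5]
  field_simp

lemma rational_key {n : ℕ} (hn : Even n) (x c : Fin n → ℂ) (hx : Function.Injective x)
    (h0 : ∀ i, x i ≠ 0) (h1 : ∀ i j, 1 + x i * x j ≠ 0) (h2 : ∀ i, 1 - x i ^ 2 ≠ 0)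
    (hc : ∀ i, ∑ j, c j * (1 + x i * x j)⁻¹ = x i / (1 - x i ^ 2)) :
    1 + ∑ j, c j * x j = (∏ i, x i) / 2 *
      (((∏ i, (1 + x i)) / (∏ i, (1 - x i)) + (∏ i, (1 - x i)) / (∏ i, (1 + x i)))
       + (∑ i, (x i + (x i)⁻¹)) *
        ((∏ i, (1 - x i)) / (∏ i, (1 + x i)) - (∏ i, (1 + x i)) / (∏ i, (1 - x i)))) := by
  classical
  open Polynomial in
  set N : ℂ[X] := (1 - X ^ 2) * ∑ j, C (c j) * ∏ k ∈ univ.erase j, (1 + X * C (x k))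
    - X * ∏ k, (1 + X * C (x k)) with hN
  have hdeg1 : ∀ s : Finset (Fin n),
      (∏ k ∈ s, (1 + Polynomial.X * Polynomial.C (x k)) : Polynomial ℂ).natDegree ≤ s.card := by
    intro s
    refine (Polynomial.natDegree_prod_le _ _).trans ?_
    rw [Finset.card_eq_sum_ones]
    refine Finset.sum_le_sum fun k _ => ?_
    compute_degree
  have hdegN : N.natDegree ≤ n + 1 := by
    rw [hN]
    refine (Polynomial.natDegree_sub_le _ _).trans (max_le ?_ ?_)
    · rcases n with _ | n
      · simp
      refine Polynomial.natDegree_mul_le.trans ?_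
      have a1 : (1 - Polynomial.X ^ 2 : Polynomial ℂ).natDegree ≤ 2 := by compute_degree
      have a2 : (∑ j, Polynomial.C (c j) * ∏ k ∈ univ.erase j,
          (1 + Polynomial.X * Polynomial.C (x k)) : Polynomial ℂ).natDegree ≤ n := by
        refine Polynomial.natDegree_sum_le_of_forall_le _ _ fun j _ => ?_
        refine (Polynomial.natDegree_C_mul_le _ _).trans ((hdeg1 _).trans ?_)
        simp
      omega
    · refine Polynomial.natDegree_mul_le.trans ?_
      have := hdeg1 univ
      rw [Polynomial.natDegree_X]
      rw [Finset.card_univ, Fintype.card_fin] at this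
      omega
  have hev : ∀ t, N.eval t = (1 - t ^ 2) * ∑ j, c j * ∏ k ∈ univ.erase j, (1 + t * x k)
      - t * ∏ k, (1 + t * x k) := by
    intro t
    simp only [hN, Polynomial.eval_finsetSum, Polynomial.eval_prod, Polynomial.eval_sub,
      Polynomial.eval_mul, Polynomial.eval_add, Polynomial.eval_one, Polynomial.eval_X,
      Polynomial.eval_C, Polynomial.eval_pow]
  have hroot : ∀ i, N.eval (x i) = 0 := by
    intro i
    rw [hev]
    have : ∑ j, c j * ∏ k ∈ univ.erase j, (1 + x i * x k)
        = (∏ k, (1 + x i * x k)) * ∑ j, c j * (1 + x i * x j)⁻¹ := by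
      rw [Finset.mul_sum]
      refine Finset.sum_congr rfl fun j _ => ?_
      rw [← Finset.mul_prod_erase univ _ (mem_univ j)]
      field_simp [h1 i j]
    rw [this, hc]
    field_simp [h2 i]
    ring
  have hdvd : Lagrange.nodal univ x ∣ N := by
    rw [Lagrange.nodal_eq]
    refine Finset.prod_dvd_of_coprime ?_ ?_
    · intro i _ j _ hij
      exact Polynomial.isCoprime_X_sub_C_of_isUnit_sub
        (sub_ne_zero.2 fun h => hij (hx h)).isUnit
    · intro i _
      exact Polynomial.dvd_iff_isRoot.2 (hroot i)
  obtain ⟨M, hM⟩ := hdvd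
  have hMdeg : M.natDegree ≤ 1 := by
    by_cases hM0 : M = 0
    · simp [hM0]
    have := congrArg Polynomial.natDegree hM
    rw [Polynomial.natDegree_mul (Lagrange.nodal_ne_zero) hM0, Lagrange.natDegree_nodal] at this
    simp at this
    omega
  obtain ⟨α, β, rfl⟩ := Polynomial.exists_eq_X_add_C_of_natDegree_le_one hMdeg
  have hevM : ∀ t, N.eval t = (∏ i, (t - x i)) * (α * t + β) := by
    intro t; rw [hM]; simp [Lagrange.eval_nodal]
  have hprodneg : ∀ f : Fin n → ℂ, ∏ i, (- f i) = ∏ i, f i := by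
    intro f; rw [Finset.prod_neg]; simp [hn.neg_one_pow]
  have hPp : ∏ i, (1 + x i) ≠ 0 := Finset.prod_ne_zero_iff.2 fun i _ h => h2 i (by
    linear_combination (1 - x i) * h)
  have hPm : ∏ i, (1 - x i) ≠ 0 := Finset.prod_ne_zero_iff.2 fun i _ h => h2 i (by
    linear_combination (1 + x i) * h)
  have q1 : (∏ i, (1 - x i)) * (α + β) = - ∏ i, (1 + x i) := by
    have := (hevM 1).symm.trans (hev 1)
    simpa using this
  have q2 : (∏ i, (1 + x i)) * (β - α) = ∏ i, (1 - x i) := by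
    have := (hevM (-1)).symm.trans (hev (-1))
    have e : ∏ i, (-1 - x i) = ∏ i, (1 + x i) := by
      rw [← hprodneg]; exact Finset.prod_congr rfl fun i _ => by ring
    rw [e] at this
    simp at this
    simp only [← sub_eq_add_neg] at this
    linear_combination this
  have q3 : ∑ j, c j = (∏ i, x i) * β := by
    have := (hevM 0).symm.trans (hev 0)
    simp only [zero_sub, hprodneg] at this
    simp at this
    exact this.symm
  have d1 : ∀ s : Finset (Fin n), (Polynomial.derivative (∏ k ∈ s,
      (1 + Polynomial.X * Polynomial.C (x k)) : Polynomial ℂ)).eval 0 = ∑ k ∈ s, x k := by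
    intro s
    rw [Polynomial.derivative_prod_finset, Polynomial.eval_finsetSum]
    refine Finset.sum_congr rfl fun k _ => ?_
    simp [Polynomial.eval_prod]
  have d2 : (Polynomial.derivative N).eval 0 = (∑ j, c j) * (∑ i, x i) - ∑ j, c j * x j - 1 := by
    have e : ∀ j, ∑ k ∈ univ.erase j, x k = (∑ i, x i) - x j := fun j => by
      rw [← Finset.add_sum_erase univ x (mem_univ j)]; ring
    rw [hN]
    simp only [Polynomial.derivative_sub, Polynomial.derivative_mul, Polynomial.derivative_sum,
      Polynomial.eval_sub, Polynomial.eval_add, Polynomial.eval_mul, Polynomial.eval_finsetSum, d1, e]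
    simp [Polynomial.eval_prod, mul_sub, Finset.sum_sub_distrib, Finset.sum_mul]
  have d3 : (Polynomial.derivative N).eval 0 =
      (∏ i, x i) * α - (∏ i, x i) * (∑ i, (x i)⁻¹) * β := by
    have e : (Polynomial.derivative (Lagrange.nodal univ x)).eval 0
        = - ((∏ i, x i) * (∑ i, (x i)⁻¹)) := by
      rw [Lagrange.nodal_eq, Polynomial.derivative_prod_finset, Polynomial.eval_finsetSum, Finset.mul_sum,
        ← Finset.sum_neg_distrib]
      refine Finset.sum_congr rfl fun k _ => ?_
      simp only [Polynomial.eval_mul, Polynomial.eval_prod]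
      simp
      rw [← hprodneg, ← Finset.mul_prod_erase univ _ (mem_univ k)]
      field_simp [h0 k]
    rw [hM]
    simp only [Polynomial.derivative_mul, Polynomial.eval_add, Polynomial.eval_mul, e,
      Lagrange.eval_nodal]
    simp [hprodneg]
    ring
  have hs : 1 + ∑ j, c j * x j = (∏ i, x i) * (-α + β * (∑ i, x i + ∑ i, (x i)⁻¹)) := by
    have := d2.symm.trans d3
    rw [q3] at this
    linear_combination -this
  rw [hs, Finset.sum_add_distrib]
  have ea : α + β = - ((∏ i, (1 + x i)) / ∏ i, (1 - x i)) := by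
    field_simp; linear_combination q1
  have eb : β - α = (∏ i, (1 - x i)) / ∏ i, (1 + x i) := by
    field_simp; linear_combination q2
  have eA : α = - ((∏ i, (1 + x i)) / ∏ i, (1 - x i)) / 2
      - ((∏ i, (1 - x i)) / ∏ i, (1 + x i)) / 2 := by rw [← ea, ← eb]; ring
  have eB : β = - ((∏ i, (1 + x i)) / ∏ i, (1 - x i)) / 2
      + ((∏ i, (1 - x i)) / ∏ i, (1 + x i)) / 2 := by rw [← ea, ← eb]; ring
  rw [eA, eB]
  ring

lemma form_factor {n : ℕ} (y s : Fin n → ℂ) (hy : Function.Injective y) (h0 : ∀ i, y i ≠ 0)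
    (h1 : ∀ i l, (y i)⁻¹ ≠ y l) (e : ℤ) :
    (Matrix.of fun j k : Fin n => ∑ i, s i * (y i ^ ((j : ℤ) - (k : ℤ) + e)
      + y i ^ (-((j : ℤ) - (k : ℤ) + e)))) =
    (vandermonde y)ᵀ * (Matrix.of fun i l : Fin n =>
      s i * y i ^ e * ((∏ k, ((y i)⁻¹ - y k)) *
        (Lagrange.nodalWeight univ y l * ((y i)⁻¹ - y l)⁻¹))
      + s l * y l ^ (-e) * ((∏ k, ((y l)⁻¹ - y k)) *
        (Lagrange.nodalWeight univ y i * ((y l)⁻¹ - y i)⁻¹))) * vandermonde y := by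
  ext j k
  simp only [Matrix.mul_apply, Matrix.transpose_apply, vandermonde_apply, Matrix.of_apply,
    mul_add, add_mul, Finset.sum_add_distrib, Finset.sum_mul]
  congr 1
  · rw [Finset.sum_comm]
    refine Finset.sum_congr rfl fun i _ => ?_
    have := lag_sum y hy (y i)⁻¹ (h1 i) k k.2
    calc _ = s i * y i ^ e * y i ^ (j : ℕ) * ((y i)⁻¹) ^ (k : ℕ) := by
          rw [← zpow_natCast, ← zpow_natCast, _root_.inv_zpow', mul_assoc, mul_assoc, ← zpow_add₀ (h0 i),
            ← zpow_add₀ (h0 i)]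
          congr 2; ring
      _ = _ := by
          rw [← this, Finset.mul_sum]
          refine Finset.sum_congr rfl fun l _ => by ring
  · refine Finset.sum_congr rfl fun l _ => ?_
    have := lag_sum y hy (y l)⁻¹ (h1 l) j j.2
    calc _ = s l * y l ^ (-e) * y l ^ (k : ℕ) * ((y l)⁻¹) ^ (j : ℕ) := by
          rw [← zpow_natCast, ← zpow_natCast, _root_.inv_zpow', mul_assoc, mul_assoc, ← zpow_add₀ (h0 l),
            ← zpow_add₀ (h0 l)]
          congr 2; ring
      _ = _ := by
          rw [← this, Finset.mul_sum]
          refine Finset.sum_congr rfl fun i _ => by ring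

lemma abstract_dets {n : ℕ} (hn : Even n) (x s : Fin n → ℂ) (κ : ℂ)
    (h0 : ∀ i, x i ≠ 0) (h1 : ∀ i l, x i ^ 2 * x l ^ 2 ≠ 1)
    (h2 : ∀ i, x i ^ 2 ≠ 1)
    (hinj : Function.Injective fun i => x i ^ 2)
    (hs : ∀ i, s i * ∏ k, ((x i ^ 2)⁻¹ - x k ^ 2) =
      κ * Lagrange.nodalWeight univ (fun i => x i ^ 2) i / (x i * (x i ^ 2 - 1)))
    (S : ℤ → ℂ) (hS : ∀ m, S m = ∑ i, s i * ((x i ^ 2) ^ m + (x i ^ 2) ^ (-m))) :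
    (Matrix.of fun j k : Fin n => S ((j : ℤ) - (k : ℤ) + 1) - S ((j : ℤ) - (k : ℤ))).det
      = (-1) ^ (n / 2) * κ ^ n / ((∏ i, x i) ^ (2 * n) *
        (∏ i, ∏ j ∈ univ.erase i, ((x i + (x i)⁻¹) + (x j + (x j)⁻¹))) * ∏ i, (x i + (x i)⁻¹)) ∧
    (Matrix.of fun j k : Fin n => S ((j : ℤ) - (k : ℤ) + 1)).det =
    (Matrix.of fun j k : Fin n => S ((j : ℤ) - (k : ℤ) + 1) - S ((j : ℤ) - (k : ℤ))).det
      * (∏ i, (1 - x i ^ 2))⁻¹ * ((∏ i, x i) / 2 *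
      (((∏ i, (1 + x i)) / (∏ i, (1 - x i)) + (∏ i, (1 - x i)) / (∏ i, (1 + x i)))
       + (∑ i, (x i + (x i)⁻¹)) *
        ((∏ i, (1 - x i)) / (∏ i, (1 + x i)) - (∏ i, (1 + x i)) / (∏ i, (1 - x i))))) := by
  classical
  set y : Fin n → ℂ := fun i => x i ^ 2 with hy
  set ω := Lagrange.nodalWeight univ y with hω
  have hxinj : Function.Injective x := fun i j h => hinj (by show x i ^ 2 = x j ^ 2; rw [h])
  have hp1 : ∀ i l, 1 + x i * x l ≠ 0 := fun i l h => h1 i l (by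
    linear_combination (x i * x l - 1) * h)
  have hm1 : ∀ i l, 1 - x i * x l ≠ 0 := fun i l h => h1 i l (by
    linear_combination - (x i * x l + 1) * h)
  have h2' : ∀ i, 1 - x i ^ 2 ≠ 0 := fun i h => h2 i (by linear_combination -h)
  have h2'' : ∀ i, x i ^ 2 - 1 ≠ 0 := fun i h => h2 i (by linear_combination h)
  have hy0 : ∀ i, y i ≠ 0 := fun i => pow_ne_zero _ (h0 i)
  have hyi : ∀ i l, (y i)⁻¹ ≠ y l := by
    intro i l h
    apply h1 i l
    change y i * y l = 1
    rw [← h, mul_inv_cancel₀ (hy0 i)]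
  have hyl : ∀ i l, ((y i)⁻¹ - y l)⁻¹ = x i ^ 2 / ((1 + x i * x l) * (1 - x i * x l)) := by
    intro i l
    rw [inv_eq_iff_eq_inv, inv_div, eq_div_iff (hy0 i), sub_mul, inv_mul_cancel₀ (hy0 i)]
    simp only [hy]; ring
  have f0 := form_factor y s hinj hy0 hyi 0
  have f1 := form_factor y s hinj hy0 hyi 1
  set Cm : Matrix (Fin n) (Fin n) ℂ := Matrix.of fun i j : Fin n => (1 + x i * x j)⁻¹ with hCm
  have g1 : (Matrix.of fun j k : Fin n => S ((j : ℤ) - (k : ℤ) + 1)) =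
      (vandermonde y)ᵀ * (diagonal (fun i => κ * ω i) *
        (Cm + vecMulVec (fun i => x i / (1 - x i ^ 2)) x) *
        diagonal (fun l => ω l * (x l)⁻¹ * (x l ^ 2 - 1)⁻¹)) * vandermonde y := by
    simp only [hS]
    rw [f1]
    congr 2
    ext i l
    simp only [Matrix.mul_diagonal, Matrix.diagonal_mul, Matrix.of_apply, Matrix.add_apply,
      vecMulVec_apply, hCm, hyl]
    have ei := hs i
    have el := hs l
    rw [zpow_one, _root_.zpow_neg_one]
    calc _ = (s i * ∏ k, ((x i ^ 2)⁻¹ - x k ^ 2)) *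
          (x i ^ 2 * ω l * (x i ^ 2 / ((1 + x i * x l) * (1 - x i * x l))))
          + (s l * ∏ k, ((x l ^ 2)⁻¹ - x k ^ 2)) *
          ((x l ^ 2)⁻¹ * ω i * (x l ^ 2 / ((1 + x l * x i) * (1 - x l * x i)))) := by
            simp only [hy]; ring
      _ = _ := by
        rw [ei, el, mul_comm (x l) (x i)]
        have a1 := h0 i
        have a2 := h0 l
        have a3 := hp1 i l
        have a4 := hm1 i l
        have a5 := h2' i
        have a6 := h2'' i
        have a7 := h2'' l
        have a8 : 1 - x i ^ 2 = -(x i ^ 2 - 1) := by ring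
        rw [a8]
        field_simp
        ring
  have g0 : (Matrix.of fun j k : Fin n => S ((j : ℤ) - (k : ℤ) + 1) - S ((j : ℤ) - (k : ℤ))) =
      (vandermonde y)ᵀ * (diagonal (fun i => - κ * ω i) * Cm *
        diagonal (fun l => ω l * (x l)⁻¹)) * vandermonde y := by
    have : (Matrix.of fun j k : Fin n => S ((j : ℤ) - (k : ℤ) + 1) - S ((j : ℤ) - (k : ℤ)))
      = (Matrix.of fun j k : Fin n => S ((j : ℤ) - (k : ℤ) + 1)) -
        (Matrix.of fun j k : Fin n => S ((j : ℤ) - (k : ℤ) + 0)) := by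
      ext j k; simp
    rw [this]
    simp only [hS]
    rw [f1, f0, ← Matrix.sub_mul, ← Matrix.mul_sub]
    congr 2
    ext i l
    simp only [Matrix.mul_diagonal, Matrix.diagonal_mul, Matrix.of_apply, Matrix.sub_apply,
      hCm, hyl]
    have ei := hs i
    have el := hs l
    rw [zpow_one, _root_.zpow_neg_one, neg_zero, zpow_zero, zpow_zero]
    calc _ = (s i * ∏ k, ((x i ^ 2)⁻¹ - x k ^ 2)) *
          ((x i ^ 2 - 1) * ω l * (x i ^ 2 / ((1 + x i * x l) * (1 - x i * x l))))
          + (s l * ∏ k, ((x l ^ 2)⁻¹ - x k ^ 2)) *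
          (((x l ^ 2)⁻¹ - 1) * ω i * (x l ^ 2 / ((1 + x l * x i) * (1 - x l * x i)))) := by
            simp only [hy]; ring
      _ = _ := by
        rw [ei, el, mul_comm (x l) (x i)]
        have a1 := h0 i
        have a2 := h0 l
        have a3 := hp1 i l
        have a4 := hm1 i l
        have a6 := h2'' i
        have a7 := h2'' l
        field_simp
        ring
  have hC := cauchy_det x hxinj h0 hp1
  rw [← hCm] at hC
  have hoff : ∏ i, ∏ j ∈ univ.erase i, (x i - x j) ≠ 0 := by
    refine Finset.prod_ne_zero_iff.2 fun i _ => Finset.prod_ne_zero_iff.2 fun j hj => ?_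
    rw [sub_ne_zero]; intro h; exact (Finset.ne_of_mem_erase hj) (hxinj h).symm
  have hoffy : ∏ i, ∏ j ∈ univ.erase i, (y i - y j) ≠ 0 := by
    refine Finset.prod_ne_zero_iff.2 fun i _ => Finset.prod_ne_zero_iff.2 fun j hj => ?_
    rw [sub_ne_zero]; intro h; exact (Finset.ne_of_mem_erase hj) (hinj h).symm
  have hPP : ∏ i, ∏ j, (1 + x i * x j) ≠ 0 :=
    Finset.prod_ne_zero_iff.2 fun i _ => Finset.prod_ne_zero_iff.2 fun j _ => hp1 i j
  have hCne : Cm.det ≠ 0 := by rw [hC]; exact div_ne_zero hoff hPP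
  have hX : ∏ i, x i ≠ 0 := Finset.prod_ne_zero_iff.2 fun i _ => h0 i
  have hκ : (-κ) ^ n = κ ^ n := hn.neg_pow κ
  constructor
  · rw [g0]
    simp only [det_mul, det_transpose, det_diagonal, Finset.prod_mul_distrib,
      Finset.prod_const, Finset.card_univ, Fintype.card_fin, hκ]
    have hv := vand_sq hn y
    have hw := prod_nodalWeight y
    rw [← hω] at hw
    have key : (∏ i, ∏ j ∈ univ.erase i, (y i - y j)) * (∏ i, ∏ j, (1 + x i * x j)) * ∏ i, x i =
        (∏ i, ∏ j ∈ univ.erase i, (x i - x j)) * ((∏ i, x i) ^ (2 * n) *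
        (∏ i, ∏ j ∈ univ.erase i, ((x i + (x i)⁻¹) + (x j + (x j)⁻¹))) * ∏ i, (x i + (x i)⁻¹)) := by
      have k1 : ∏ i, ∏ j, (1 + x i * x j) = (∏ i, x i) * (∏ i, (x i + (x i)⁻¹)) *
          ∏ i, ∏ j ∈ univ.erase i, (1 + x i * x j) := by
        rw [← Finset.prod_mul_distrib, ← Finset.prod_mul_distrib]
        refine Finset.prod_congr rfl fun i _ => ?_
        rw [← Finset.mul_prod_erase univ _ (mem_univ i)]
        congr 1
        have := h0 i
        field_simp
        ring
      have k2 : (∏ i, ∏ j ∈ univ.erase i, (y i - y j)) * ∏ i, ∏ j ∈ univ.erase i, (1 + x i * x j)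
          = (∏ i, ∏ j ∈ univ.erase i, (x i - x j)) * ((∏ i, ∏ j ∈ univ.erase i, (x i * x j)) *
           (∏ i, ∏ j ∈ univ.erase i, ((x i + (x i)⁻¹) + (x j + (x j)⁻¹)))) := by
        simp only [← Finset.prod_mul_distrib]
        refine Finset.prod_congr rfl fun i _ => Finset.prod_congr rfl fun j _ => ?_
        have a := h0 i
        have b := h0 j
        simp only [hy]
        field_simp
        ring
      rw [prod_offdiag_pow] at k2
      have k3 : (∏ i, x i) ^ (2 * n) = (∏ i, x i) ^ (2 * (n - 1)) * (∏ i, x i) ^ 2 := by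
        rcases n with _ | n
        · simp
        · rw [← pow_add]; congr 1
      rw [k1, k3]
      linear_combination (∏ i, x i) ^ 2 * (∏ i, (x i + (x i)⁻¹)) * k2
    have hne : ((∏ i, x i) ^ (2 * n) *
        (∏ i, ∏ j ∈ univ.erase i, ((x i + (x i)⁻¹) + (x j + (x j)⁻¹))) * ∏ i, (x i + (x i)⁻¹)) ≠ 0 := by
      intro h
      rw [h, mul_zero] at key
      exact mul_ne_zero (mul_ne_zero hoffy hPP) hX key
    rw [eq_div_iff hne, hw, hC]
    have : (∏ i, (x i)⁻¹) = (∏ i, x i)⁻¹ := Finset.prod_inv_distrib _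
    rw [this]
    generalize ((∏ i, x i) ^ (2 * n) * (∏ i, ∏ j ∈ univ.erase i, ((x i + (x i)⁻¹) +
      (x j + (x j)⁻¹))) * ∏ i, (x i + (x i)⁻¹)) = Q at key hne ⊢
    generalize (∏ i, ∏ j ∈ univ.erase i, (y i - y j)) = Y at *
    generalize (∏ i, ∏ j ∈ univ.erase i, (x i - x j)) = Z at *
    generalize (∏ i, ∏ j, (1 + x i * x j)) = R at *
    generalize (∏ i, x i) = W at *
    generalize (vandermonde y).det = V at *
    generalize (-1 : ℂ) ^ (n / 2) = u at *
    generalize κ ^ n = v at *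
    field_simp
    linear_combination v * Z * Q * hv - u * v * Y * key
  · have hCu : IsUnit Cm.det := hCne.isUnit
    set c : Fin n → ℂ := Cm⁻¹ *ᵥ (fun i => x i / (1 - x i ^ 2)) with hc
    have hCc : Cm *ᵥ c = fun i => x i / (1 - x i ^ 2) := by
      rw [hc, Matrix.mulVec_mulVec, Matrix.mul_nonsing_inv _ hCu, Matrix.one_mulVec]
    have hr := rational_key hn x c hxinj h0 hp1 h2' (by
      intro i
      have := congrFun hCc i
      rw [← this, mulVec, dotProduct]
      exact Finset.sum_congr rfl fun j _ => by simp [hCm, mul_comm])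
    rw [← hr]
    have hdet : (Cm + vecMulVec (fun i => x i / (1 - x i ^ 2)) x).det
        = Cm.det * (1 + ∑ j, c j * x j) := by
      have e1 : Cm + vecMulVec (fun i => x i / (1 - x i ^ 2)) x =
          Cm * (1 + replicateCol Unit c * replicateRow Unit x) := by
        rw [Matrix.mul_add, Matrix.mul_one, ← Matrix.mul_assoc, ← replicateCol_mulVec, hCc]
        congr 1
        rw [vecMulVec_eq Unit]
      rw [e1, det_mul, det_one_add_replicateCol_mul_replicateRow]
      congr 2
      simp [dotProduct, mul_comm]
    rw [g0, g1]
    simp only [det_mul, det_transpose, det_diagonal, hdet, Finset.prod_mul_distrib,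
      Finset.prod_const, Finset.card_univ, Fintype.card_fin, hκ]
    have e : ∏ i, (x i ^ 2 - 1)⁻¹ = (∏ i, (1 - x i ^ 2))⁻¹ := by
      rw [Finset.prod_inv_distrib]
      congr 1
      have : ∏ i, (-(1 - x i ^ 2)) = ∏ i, (1 - x i ^ 2) := by
        rw [Finset.prod_neg]; simp [hn.neg_one_pow]
      rw [← this]
      exact Finset.prod_congr rfl fun i _ => by ring
    rw [e]
    ring

lemma prod_zmod_range {p : ℕ} [Fact p.Prime] {M : Type*} [CommMonoid M] (f : ZMod p → M) :
    ∏ u, f u = ∏ k ∈ range p, f (k : ZMod p) := by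
  refine Finset.prod_bij' (fun u _ => u.val) (fun k _ => (k : ZMod p)) ?_ ?_ ?_ ?_ ?_
  · intro u _; simpa using ZMod.val_lt u
  · intro u _; simp
  · intro u _; simp
  · intro k hk; simpa using ZMod.val_cast_of_lt (by simpa using hk)
  · intro u _; simp

/-- the half system -/
def hsys (p n : ℕ) (i : Fin n) : ZMod p := (((i : ℕ) + 1 : ℕ) : ZMod p)

lemma prod_erase_range {p m : ℕ} [Fact p.Prime] (hpn : p = m + 1) {M : Type*} [CommMonoid M]
    (f : ZMod p → M) :
    ∏ u ∈ univ.erase 0, f u = ∏ k ∈ range m, f ((k + 1 : ℕ) : ZMod p) := by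
  have h : ∏ u ∈ univ.erase 0, f u = ∏ u, (if u = 0 then 1 else f u) := by
    rw [← Finset.mul_prod_erase univ _ (mem_univ 0)]
    simp only [if_true, one_mul]
    exact Finset.prod_congr rfl fun u hu => by rw [if_neg (Finset.ne_of_mem_erase hu)]
  rw [h, prod_zmod_range]
  have h2 : range p = range (m + 1) := by rw [hpn]
  rw [h2, Finset.prod_range_succ']
  simp only [Nat.cast_zero, if_true, mul_one]
  refine Finset.prod_congr rfl fun k hk => ?_
  rw [if_neg]
  intro h
  rw [ZMod.natCast_eq_zero_iff] at h
  have := Nat.le_of_dvd (by omega) h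
  have := mem_range.1 hk
  omega

lemma prod_half {p n : ℕ} [Fact p.Prime] (hpn : p = 2 * n + 1) {M : Type*} [CommMonoid M]
    (f : ZMod p → M) :
    ∏ u ∈ univ.erase 0, f u = ∏ i : Fin n, (f (hsys p n i) * f (-hsys p n i)) := by
  rw [prod_erase_range (m := n + n) (by omega), Finset.prod_range_add]
  unfold hsys
  rw [Finset.prod_mul_distrib, ← Finset.prod_range_reflect (fun x => f ((n + x + 1 : ℕ) : ZMod p)),
      Fin.prod_univ_eq_prod_range
      (fun i => f ((i + 1 : ℕ) : ZMod p)), Fin.prod_univ_eq_prod_range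
      (fun i => f (-((i + 1 : ℕ) : ZMod p)))]
  congr 1
  refine Finset.prod_congr rfl fun k hk => ?_
  have hk := mem_range.1 hk
  congr 1
  rw [eq_neg_iff_add_eq_zero, ← Nat.cast_add, ZMod.natCast_eq_zero_iff]
  exact ⟨1, by omega⟩

lemma sum_half {p n : ℕ} [Fact p.Prime] (hpn : p = 2 * n + 1) (f : ZMod p → ℂ) :
    ∑ u ∈ univ.erase 0, f u = ∑ i : Fin n, (f (hsys p n i) + f (-hsys p n i)) :=
  prod_half (M := Multiplicative ℂ) hpn f

lemma hsys_ne_zero {p n : ℕ} [Fact p.Prime] (hpn : p = 2 * n + 1) (i : Fin n) : hsys p n i ≠ 0 := by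
  intro h
  rw [hsys, ZMod.natCast_eq_zero_iff] at h
  have := Nat.le_of_dvd (by omega) h
  omega

lemma hsys_add_ne_zero {p n : ℕ} [Fact p.Prime] (hpn : p = 2 * n + 1) (i j : Fin n) :
    hsys p n i + hsys p n j ≠ 0 := by
  intro h
  rw [hsys, hsys, ← Nat.cast_add, ZMod.natCast_eq_zero_iff] at h
  have := Nat.le_of_dvd (by omega) h
  omega

lemma hsys_inj {p n : ℕ} [Fact p.Prime] (hpn : p = 2 * n + 1) : Function.Injective (hsys p n) := by
  intro i j h
  have h1 := congrArg ZMod.val h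
  rw [hsys, hsys, ZMod.val_cast_of_lt (by omega), ZMod.val_cast_of_lt (by omega)] at h1
  ext; omega

/-- additive character -/
noncomputable abbrev psi (p : ℕ) [Fact p.Prime] : AddChar (ZMod p) ℂ := ZMod.stdAddChar (N := p)

/-- quadratic character -/
noncomputable def chi (p : ℕ) [Fact p.Prime] : MulChar (ZMod p) ℂ :=
  (quadraticChar (ZMod p)).ringHomComp (Int.castRingHom ℂ)

lemma psi_ne_zero {p : ℕ} [Fact p.Prime] (u : ZMod p) : psi p u ≠ 0 := by
  intro h
  have := AddChar.map_neg_eq_inv (psi p) u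
  have h2 : psi p (u + -u) = 1 := by simp
  rw [AddChar.map_add_eq_mul, h, zero_mul] at h2
  exact zero_ne_one h2

lemma psi_eq_one_iff {p : ℕ} [Fact p.Prime] (u : ZMod p) : psi p u = 1 ↔ u = 0 := by
  constructor
  · intro h
    exact ZMod.injective_stdAddChar (by rw [h, AddChar.map_zero_eq_one])
  · rintro rfl; exact AddChar.map_zero_eq_one _

lemma psi_prim {p : ℕ} [Fact p.Prime] : IsPrimitiveRoot (psi p 1) p := by
  have h : psi p 1 = Complex.exp (2 * Real.pi * Complex.I / p) := by
    have := ZMod.stdAddChar_coe (N := p) 1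
    simpa using this
  rw [h]
  exact Complex.isPrimitiveRoot_exp p (Nat.Prime.ne_zero Fact.out)

lemma psi_natCast {p : ℕ} [Fact p.Prime] (k : ℕ) : psi p (k : ZMod p) = psi p 1 ^ k := by
  rw [← AddChar.map_nsmul_eq_pow]; simp

lemma psi_pow {p : ℕ} [Fact p.Prime] (u : ZMod p) (k : ℕ) : psi p u ^ k = psi p (k * u) := by
  rw [← AddChar.map_nsmul_eq_pow]; simp

lemma prod_erase_scale {p : ℕ} [Fact p.Prime] (d : ZMod p) (hd : d ≠ 0) {M : Type*} [CommMonoid M]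
    (f : ZMod p → M) : ∏ u ∈ univ.erase 0, f (d * u) = ∏ u ∈ univ.erase 0, f u := by
  refine Finset.prod_bij' (fun u _ => d * u) (fun u _ => d⁻¹ * u) ?_ ?_ ?_ ?_ ?_ <;>
    simp [hd]

lemma prod_psi {p n : ℕ} [Fact p.Prime] (hpn : p = 2 * n + 1) (d : ZMod p) :
    ∏ u ∈ univ.erase 0, psi p (d * u) = 1 := by
  rw [prod_half hpn]
  refine Finset.prod_eq_one fun i _ => ?_
  rw [← AddChar.map_add_eq_mul]; simp

lemma prod_one_sub_psi {p : ℕ} [Fact p.Prime] (d : ZMod p) (hd : d ≠ 0) :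
    ∏ u ∈ univ.erase 0, (1 - psi p (d * u)) = p := by
  rw [prod_erase_scale d hd (fun u => 1 - psi p u)]
  have h1 := psi_prim (p := p)
  obtain ⟨m, hm⟩ : ∃ m, p = m + 1 := ⟨p - 1, by have := (Fact.out : p.Prime).pos; omega⟩
  have h1' : IsPrimitiveRoot (psi p 1) (m + 1) := hm ▸ h1
  have h := h1'.prod_one_sub_pow_eq_order
  rw [prod_erase_range hm]
  simp only [psi_natCast]
  rw [h, hm]; push_cast; rfl

lemma chi_sq {p : ℕ} [Fact p.Prime] (u : ZMod p) (hu : u ≠ 0) : chi p u ^ 2 = 1 := by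
  simp only [chi, MulChar.ringHomComp_apply]
  rw [← map_pow, quadraticChar_sq_one hu, map_one]

lemma chi_cases {p : ℕ} [Fact p.Prime] (u : ZMod p) (hu : u ≠ 0) : chi p u = 1 ∨ chi p u = -1 :=
  by
  have := chi_sq u hu
  exact sq_eq_sq_iff_eq_or_eq_neg.1 (by simpa using this)

lemma chi_legendre {p : ℕ} [Fact p.Prime] (a : ℤ) : chi p (a : ZMod p) = (legendreSym p a : ℂ) := rfl

lemma chi_zero {p : ℕ} [Fact p.Prime] : chi p 0 = 0 := MulChar.map_zero _

lemma chi_neg_one {p : ℕ} [Fact p.Prime] (hp4 : p % 4 = 1) : chi p (-1) = 1 := by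
  have h2 : p ≠ 2 := by rintro rfl; omega
  have h := legendreSym.at_neg_one (p := p) h2
  have h3 := chi_legendre (p := p) (-1)
  rw [h, ZMod.χ₄_nat_one_mod_four hp4] at h3
  simpa using h3

lemma chi_neg {p : ℕ} [Fact p.Prime] (hp4 : p % 4 = 1) (u : ZMod p) : chi p (-u) = chi p u := by
  rw [← neg_one_mul, map_mul, chi_neg_one hp4, one_mul]

lemma chi_ne_one {p : ℕ} [Fact p.Prime] (hp4 : p % 4 = 1) : chi p ≠ 1 := by
  have h2 : ringChar (ZMod p) ≠ 2 := by rw [ZMod.ringChar_zmod_n]; rintro rfl; omega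
  obtain ⟨a, ha⟩ := quadraticChar_exists_neg_one h2
  intro h
  have h0 : a ≠ 0 := by rintro rfl; simp at ha
  have : chi p a = -1 := by simp [chi, ha]
  rw [h, MulChar.one_apply (isUnit_iff_ne_zero.2 h0)] at this
  norm_num at this

lemma chi_quad {p : ℕ} [Fact p.Prime] : (chi p).IsQuadratic := by
  intro u
  by_cases h : u = 0
  · left; rw [h, MulChar.map_zero]
  · right; exact chi_cases u h

noncomputable def gs (p : ℕ) [Fact p.Prime] : ℂ := gaussSum (chi p) (psi p)

lemma gs_sq {p : ℕ} [Fact p.Prime] (hp4 : p % 4 = 1) : gs p ^ 2 = p := by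
  have := gaussSum_sq (χ := chi p) (chi_ne_one hp4) chi_quad (ZMod.isPrimitive_stdAddChar p)
  rw [gs, this, chi_neg_one hp4,
    ZMod.card, one_mul]

lemma gs_ne_zero {p : ℕ} [Fact p.Prime] (hp4 : p % 4 = 1) : gs p ≠ 0 := by
  intro h
  have := gs_sq hp4
  rw [h] at this
  have h3 : (p : ℂ) ≠ 0 := Nat.cast_ne_zero.2 (Nat.Prime.ne_zero Fact.out)
  exact h3 (by rw [← this]; simp)

lemma sum_chi_psi {p : ℕ} [Fact p.Prime] (hp4 : p % 4 = 1) (m : ZMod p) :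
    ∑ u ∈ univ.erase 0, chi p u * psi p (u * m) = chi p m * gs p := by
  have e : ∑ u ∈ univ.erase 0, chi p u * psi p (u * m) = ∑ u, chi p u * psi p (u * m) := by
    rw [← Finset.add_sum_erase univ _ (mem_univ 0)]
    simp [chi_zero]
  rw [e]
  by_cases h : m = 0
  · subst h
    simp [chi_zero, MulChar.sum_eq_zero_of_ne_one (chi_ne_one hp4)]
  · have := gaussSum_mulShift (chi p) (psi p) (Units.mk0 m h)
    rw [gs, ← this, ← mul_assoc, Units.val_mk0, ← pow_two, chi_sq m h, one_mul, gaussSum]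
    simp [AddChar.mulShift_apply, mul_comm]

lemma two_ne_zmod {p : ℕ} [Fact p.Prime] (hp4 : p % 4 = 1) : (2 : ZMod p) ≠ 0 := by
  intro h
  have : ((2 : ℕ) : ZMod p) = 0 := by simpa using h
  rw [ZMod.natCast_eq_zero_iff] at this
  have := Nat.le_of_dvd (by omega) this
  have h1 := (Fact.out : p.Prime).two_le
  have : p = 2 := by omega
  omega

noncomputable def xx (p n : ℕ) [Fact p.Prime] (i : Fin n) : ℂ :=
  chi p (hsys p n i) * psi p (hsys p n i)

lemma xx_sq {p n : ℕ} [Fact p.Prime] (hpn : p = 2 * n + 1) (i : Fin n) :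
    xx p n i ^ 2 = psi p (2 * hsys p n i) := by
  rw [xx, mul_pow, chi_sq _ (hsys_ne_zero hpn i), one_mul, psi_pow]; norm_num

lemma psi_zpow {p : ℕ} [Fact p.Prime] (u : ZMod p) (k : ℤ) : psi p u ^ k = psi p (u * k) := by
  rw [← AddChar.map_zsmul_eq_zpow]; simp [mul_comm]

lemma chi_expand {p n : ℕ} [Fact p.Prime] (hp4 : p % 4 = 1) (hpn : p = 2 * n + 1) (m : ℤ) :
    chi p (m : ZMod p) = ∑ i, (chi p (2 * hsys p n i) / gs p) *
      ((xx p n i ^ 2) ^ m + (xx p n i ^ 2) ^ (-m)) := by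
  have h := sum_chi_psi hp4 (m : ZMod p)
  have h2 : ∑ u ∈ univ.erase 0, chi p (2 * u) * psi p ((2 * u) * m) = chi p m * gs p := by
    rw [← h]
    exact prod_erase_scale (M := Multiplicative ℂ) 2 (two_ne_zmod hp4)
      (fun u => chi p u * psi p (u * m))
  rw [sum_half hpn] at h2
  rw [← mul_div_cancel_right₀ (chi p m) (gs_ne_zero hp4), ← h2, Finset.sum_div]
  refine Finset.sum_congr rfl fun i _ => ?_
  rw [xx_sq hpn, psi_zpow, psi_zpow, mul_neg, chi_neg hp4]
  push_cast
  rw [neg_mul, mul_neg]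
  ring

lemma xx_ne_zero {p n : ℕ} [Fact p.Prime] (hpn : p = 2 * n + 1) (i : Fin n) : xx p n i ≠ 0 := by
  intro h
  have := xx_sq hpn i
  rw [h] at this
  exact psi_ne_zero _ (by rw [← this]; simp)

lemma prod_psi_diff {p : ℕ} [Fact p.Prime] (w : ZMod p) :
    ∏ v ∈ univ.erase w, (psi p w - psi p v) = p * psi p (-w) := by
  have : ∏ v ∈ univ.erase w, (psi p w - psi p v) = ∏ u ∈ univ.erase 0,
      (psi p w * (1 - psi p (1 * u))) := by
    refine Finset.prod_bij' (fun v _ => v - w) (fun u _ => w + u) ?_ ?_ ?_ ?_ ?_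
    · intro v hv; simpa [sub_eq_zero] using hv
    · intro v hv; simpa using hv
    · intro v hv; simp
    · intro v hv; simp
    · intro v hv
      rw [mul_sub, ← AddChar.map_add_eq_mul]; simp
  rw [this, Finset.prod_mul_distrib, prod_one_sub_psi 1 one_ne_zero, Finset.prod_const, psi_pow,
    mul_comm]
  congr 2
  rw [Finset.card_erase_of_mem (mem_univ _), Finset.card_univ, ZMod.card,
    Nat.cast_sub (Fact.out : p.Prime).one_le]
  simp

noncomputable def kap (p n : ℕ) [Fact p.Prime] : ℂ :=
  chi p 2 * (p * ∏ i, xx p n i ^ 2) / gs p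

lemma hs_hyp {p n : ℕ} [Fact p.Prime] (hp4 : p % 4 = 1) (hpn : p = 2 * n + 1) (i : Fin n) :
    (chi p (2 * hsys p n i) / gs p) * ∏ k, ((xx p n i ^ 2)⁻¹ - xx p n k ^ 2) =
      kap p n * Lagrange.nodalWeight univ (fun i => xx p n i ^ 2) i /
        (xx p n i * (xx p n i ^ 2 - 1)) := by
  have hn : Even n := ⟨n / 2, by omega⟩
  set h := hsys p n i with hh
  have two := two_ne_zmod hp4
  -- full product at y_i
  have h1 := prod_psi_diff (2 * h)
  have h2 : ∏ v ∈ univ.erase (2 * h), (psi p (2 * h) - psi p v) =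
      (psi p (2 * h) - 1) * ((∏ k ∈ univ.erase i, (xx p n i ^ 2 - xx p n k ^ 2)) *
        ∏ k, (xx p n i ^ 2 - (xx p n k ^ 2)⁻¹)) := by
    have e1 : ∏ v ∈ univ.erase (2 * h), (psi p (2 * h) - psi p v) =
        ∏ v, (if v = 2 * h then 1 else (psi p (2 * h) - psi p v)) := by
      rw [← Finset.mul_prod_erase univ _ (mem_univ (2 * h)), if_pos rfl, one_mul]
      exact Finset.prod_congr rfl fun u hu => by rw [if_neg (Finset.ne_of_mem_erase hu)]
    rw [e1, ← Finset.mul_prod_erase univ _ (mem_univ 0), if_neg, AddChar.map_zero_eq_one]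
    · congr 1
      rw [← prod_erase_scale 2 two, prod_half hpn, Finset.prod_mul_distrib]
      congr 1
      · rw [← Finset.mul_prod_erase univ _ (mem_univ i), if_pos rfl, one_mul]
        refine Finset.prod_congr rfl fun k hk => ?_
        rw [if_neg, xx_sq hpn, xx_sq hpn]
        intro hc
        exact (Finset.ne_of_mem_erase hk) (hsys_inj hpn (mul_left_cancel₀ two hc))
      · refine Finset.prod_congr rfl fun k hk => ?_
        rw [if_neg, xx_sq hpn, xx_sq hpn, ← AddChar.map_neg_eq_inv, mul_neg]
        intro hc
        have := mul_left_cancel₀ two hc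
        exact hsys_add_ne_zero hpn i k (by rw [← hh, ← this]; ring)
    · exact (mul_ne_zero two (hsys_ne_zero hpn i)).symm
  have h3 : ∏ k, ((xx p n i ^ 2)⁻¹ - xx p n k ^ 2) = psi p h * (∏ k, xx p n k ^ 2) *
      ∏ k, (xx p n i ^ 2 - (xx p n k ^ 2)⁻¹) := by
    have e1 : ∀ k, ((xx p n i ^ 2)⁻¹ - xx p n k ^ 2) = (-(xx p n i ^ 2)⁻¹) * (xx p n k ^ 2) *
      (xx p n i ^ 2 - (xx p n k ^ 2)⁻¹) := by
      intro k
      have a := xx_ne_zero hpn i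
      have b := xx_ne_zero hpn k
      field_simp
      ring
    simp only [fun k => e1 k, Finset.prod_mul_distrib, Finset.prod_const, Finset.card_univ, Fintype.card_fin,
      hn.neg_pow]
    congr 2
    rw [xx_sq hpn, ← AddChar.map_neg_eq_inv, psi_pow]
    congr 1
    have : (2 * (n : ZMod p) + 1) = 0 := by
      have : ((2 * n + 1 : ℕ) : ZMod p) = 0 := by rw [← hpn]; simp
      simpa using this
    linear_combination -h * this
  have hden : psi p (2 * h) - 1 ≠ 0 := by
    rw [sub_ne_zero, Ne, psi_eq_one_iff]; exact mul_ne_zero two (hsys_ne_zero hpn i)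
  have hne : ∏ k ∈ univ.erase i, (xx p n i ^ 2 - xx p n k ^ 2) ≠ 0 := by
    refine Finset.prod_ne_zero_iff.2 fun k hk => ?_
    rw [sub_ne_zero, xx_sq hpn, xx_sq hpn]
    intro hc
    exact (Finset.ne_of_mem_erase hk) (hsys_inj hpn (mul_left_cancel₀ two
      (ZMod.injective_stdAddChar hc))).symm
  rw [h1] at h2
  have h4 : xx p n i = chi p h * psi p h := rfl
  rw [h3, kap, Lagrange.nodalWeight, Finset.prod_inv_distrib]
  have hx : xx p n i ^ 2 - 1 = psi p (2 * h) - 1 := by rw [xx_sq hpn]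
  rw [hx, map_mul]
  generalize ∏ k ∈ univ.erase i, (xx p n i ^ 2 - xx p n k ^ 2) = U at *
  generalize ∏ k, (xx p n i ^ 2 - (xx p n k ^ 2)⁻¹) = V at *
  generalize ∏ k, xx p n k ^ 2 = W at *
  have hc := chi_sq h (hsys_ne_zero hpn i)
  have hc0 : chi p h ≠ 0 := by intro h; rw [h] at hc; norm_num at hc
  have hp : psi p (-(2 * h)) * psi p h ^ 2 = 1 := by
    rw [psi_pow, ← AddChar.map_add_eq_mul]; simp
  have hp0 := psi_ne_zero h
  have hg := gs_ne_zero hp4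
  rw [h4]
  field_simp
  linear_combination (-chi p 2 * W * psi p h ^ 2) * h2 + (chi p 2 * W * p) * hp + (chi p 2 * W * V * U * psi p h^2 * (psi p (2 * h)-1)) * hc

noncomputable def cc (p : ℕ) [Fact p.Prime] (u : ZMod p) : ℂ := psi p u + psi p (-u)
noncomputable def TT (p : ℕ) [Fact p.Prime] (u : ZMod p) : ℂ := chi p u * cc p u

lemma TT_neg {p : ℕ} [Fact p.Prime] (hp4 : p % 4 = 1) (u : ZMod p) : TT p (-u) = TT p u := by
  rw [TT, TT, chi_neg hp4, cc, cc, neg_neg, add_comm]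

lemma TT_xx {p n : ℕ} [Fact p.Prime] (hpn : p = 2 * n + 1) (i : Fin n) :
    xx p n i + (xx p n i)⁻¹ = TT p (hsys p n i) := by
  have hc := chi_sq (hsys p n i) (hsys_ne_zero hpn i)
  have : (chi p (hsys p n i))⁻¹ = chi p (hsys p n i) := by
    rcases chi_cases (hsys p n i) (hsys_ne_zero hpn i) with h | h <;> rw [h] <;> norm_num
  rw [TT, cc, xx, mul_inv, this, AddChar.map_neg_eq_inv, mul_add]

lemma prod_chi {p n : ℕ} [Fact p.Prime] (hp4 : p % 4 = 1) (hpn : p = 2 * n + 1) :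
    ∏ u ∈ univ.erase 0, chi p u = 1 := by
  rw [prod_half hpn]
  refine Finset.prod_eq_one fun i _ => ?_
  rw [chi_neg hp4, ← pow_two, chi_sq _ (hsys_ne_zero hpn i)]

lemma prod_cc_sub {p n : ℕ} [Fact p.Prime] (hpn : p = 2 * n + 1)
    (t : ZMod p) (h1 : t ≠ 1) (h2 : t ≠ -1) :
    ∏ u ∈ univ.erase 0, (cc p u - cc p (u * t)) = (p : ℂ) ^ 2 := by
  have : ∀ u, cc p u - cc p (u * t) = psi p (1 * u) * (1 - psi p ((t - 1) * u)) *
      (1 - psi p (-(t + 1) * u)) := by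
    intro u
    have e1 : psi p ((t - 1) * u) = psi p (u * t) * (psi p u)⁻¹ := by
      rw [← AddChar.map_neg_eq_inv, ← AddChar.map_add_eq_mul]; congr 1; ring
    have e2 : psi p (-(t + 1) * u) = (psi p (u * t))⁻¹ * (psi p u)⁻¹ := by
      rw [← AddChar.map_neg_eq_inv, ← AddChar.map_neg_eq_inv, ← AddChar.map_add_eq_mul]
      congr 1; ring
    rw [e1, e2, cc, cc, AddChar.map_neg_eq_inv, AddChar.map_neg_eq_inv, one_mul]
    have a := psi_ne_zero u
    have b := psi_ne_zero (u * t)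
    field_simp
    ring
  simp only [this, Finset.prod_mul_distrib]
  rw [prod_psi hpn, prod_one_sub_psi _ (sub_ne_zero.2 h1), prod_one_sub_psi]
  · ring
  · rw [neg_ne_zero]; intro h; exact h2 (by linear_combination h)

lemma cc_sq {p : ℕ} [Fact p.Prime] (u : ZMod p) : cc p u ^ 2 = cc p (2 * u) + 2 := by
  have e1 : psi p (2 * u) = psi p u ^ 2 := by rw [psi_pow]; norm_num
  have e2 : psi p (-(2 * u)) = psi p (-u) ^ 2 := by rw [psi_pow]; congr 1; push_cast; ring
  rw [cc, cc, e1, e2, AddChar.map_neg_eq_inv]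
  have a := psi_ne_zero u
  field_simp
  ring

lemma prod_cc_add {p n : ℕ} [Fact p.Prime] (hp4 : p % 4 = 1) (hpn : p = 2 * n + 1)
    (t : ZMod p) (h1 : t ≠ 1) (h2 : t ≠ -1) :
    ∏ u ∈ univ.erase 0, (cc p u + cc p (u * t)) = 1 := by
  have h := prod_cc_sub hpn t h1 h2
  have h' := prod_erase_scale 2 (two_ne_zmod hp4) (fun u => cc p u - cc p (u * t))
  have e : ∀ u, cc p (2 * u) - cc p (2 * u * t) = (cc p u - cc p (u * t)) * (cc p u + cc p (u * t)) := by
    intro u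
    have a := cc_sq u
    have b := cc_sq (u * t)
    rw [mul_assoc]
    linear_combination b - a
  simp only [e, Finset.prod_mul_distrib] at h'
  rw [h] at h'
  have h3 : (p : ℂ) ^ 2 ≠ 0 := pow_ne_zero _ (Nat.cast_ne_zero.2 (Nat.Prime.ne_zero Fact.out))
  exact mul_left_cancel₀ h3 (by rw [h', mul_one])

lemma prod_TT {p n : ℕ} [Fact p.Prime] (hp4 : p % 4 = 1) (hpn : p = 2 * n + 1)
    (t : ZMod p) (h0 : t ≠ 0) (h1 : t ≠ 1) (h2 : t ≠ -1) :
    ∏ u ∈ univ.erase 0, (TT p u + TT p (u * t)) = if chi p t = -1 then (p : ℂ) ^ 2 else 1 := by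
  have : ∀ u, TT p u + TT p (u * t) = chi p u * (cc p u + chi p t * cc p (u * t)) := by
    intro u; rw [TT, TT, map_mul]; ring
  simp only [this, Finset.prod_mul_distrib, prod_chi hp4 hpn, one_mul]
  rcases chi_cases t h0 with h | h
  · rw [h, if_neg (by norm_num)]
    simpa using prod_cc_add hp4 hpn t h1 h2
  · rw [h, if_pos rfl]
    simpa [← sub_eq_add_neg] using prod_cc_sub hpn t h1 h2

lemma card_nonres {p n : ℕ} [Fact p.Prime] (hp4 : p % 4 = 1) (hpn : p = 2 * n + 1) :
    ((univ.erase (0 : ZMod p)).filter (fun t => chi p t = -1)).card = n := by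
  have h : ∑ u ∈ univ.erase 0, chi p u = 0 := by
    have := sum_chi_psi hp4 0
    simpa [chi_zero] using this
  have h2 : ∑ u ∈ univ.erase 0, chi p u = ∑ u ∈ univ.erase 0, (1 - if chi p u = -1 then (2 : ℂ) else 0) := by
    refine Finset.sum_congr rfl fun u hu => ?_
    rcases chi_cases u (Finset.ne_of_mem_erase hu) with h | h <;> rw [h] <;> norm_num
  rw [h, Finset.sum_sub_distrib, ← Finset.sum_filter, Finset.sum_const, Finset.sum_const,
    Finset.card_erase_of_mem (mem_univ _), Finset.card_univ, ZMod.card] at h2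
  have h3 : p - 1 = 2 * n := by omega
  rw [h3] at h2
  simp only [nsmul_eq_mul] at h2
  have : ((2 * n : ℕ) : ℂ) = ((((univ.erase (0 : ZMod p)).filter (fun t => chi p t = -1)).card * 2 : ℕ) : ℂ) := by
    push_cast at h2 ⊢
    linear_combination -h2
  have := Nat.cast_injective this
  omega

lemma D_pow4 {p n : ℕ} [Fact p.Prime] (hp4 : p % 4 = 1) (hpn : p = 2 * n + 1) :
    (∏ i : Fin n, ∏ j ∈ univ.erase i, (TT p (hsys p n i) + TT p (hsys p n j))) ^ 4 = (p : ℂ) ^ (2 * n) := by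
  classical
  set g : ZMod p → ZMod p → ℂ := fun u v => if v = u ∨ v = -u then 1 else TT p u + TT p v with hg
  have g1 : ∀ u v, g (-u) v = g u v := by
    intro u v; simp only [hg, neg_neg, TT_neg hp4, or_comm]
  have g2 : ∀ u v, g u (-v) = g u v := by
    intro u v; simp only [hg, TT_neg hp4, neg_eq_iff_eq_neg]; simp only [neg_neg, or_comm]
  have g3 : ∀ i : Fin n, ∏ j, g (hsys p n i) (hsys p n j) =
      ∏ j ∈ univ.erase i, (TT p (hsys p n i) + TT p (hsys p n j)) := by
    intro i
    rw [← Finset.mul_prod_erase univ _ (mem_univ i)]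
    have : g (hsys p n i) (hsys p n i) = 1 := by simp [hg]
    rw [this, one_mul]
    refine Finset.prod_congr rfl fun j hj => ?_
    simp only [hg]
    rw [if_neg]
    rintro (h | h)
    · exact (Finset.ne_of_mem_erase hj) (hsys_inj hpn h)
    · exact hsys_add_ne_zero hpn i j (by rw [h]; ring)
  have e1 : (∏ i : Fin n, ∏ j ∈ univ.erase i, (TT p (hsys p n i) + TT p (hsys p n j))) ^ 4 =
      ∏ u ∈ univ.erase 0, ∏ v ∈ univ.erase 0, g u v := by
    rw [prod_half hpn]
    simp only [g1, prod_half hpn (fun v => g _ v), g2, Finset.prod_mul_distrib, g3]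
    ring
  have e2 : ∀ u ∈ univ.erase (0 : ZMod p), ∏ v ∈ univ.erase 0, g u v =
      ∏ t ∈ univ.erase 0, (if t = 1 ∨ t = -1 then 1 else TT p u + TT p (u * t)) := by
    intro u hu
    have hu := Finset.ne_of_mem_erase hu
    rw [← prod_erase_scale u hu]
    refine Finset.prod_congr rfl fun t _ => ?_
    simp only [hg]
    have : (u * t = u ∨ u * t = -u) ↔ (t = 1 ∨ t = -1) := by
      have a : u * t = u ↔ t = 1 := by simp [hu]
      have b : u * t = -u ↔ t = -1 := by
        constructor
        · intro h; exact mul_left_cancel₀ hu (by rw [h]; ring)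
        · rintro rfl; ring
      rw [a, b]
    simp only [this]
  rw [e1, Finset.prod_congr rfl e2, Finset.prod_comm]
  have e3 : ∀ t ∈ univ.erase (0 : ZMod p), ∏ u ∈ univ.erase 0,
      (if t = 1 ∨ t = -1 then 1 else TT p u + TT p (u * t)) = if chi p t = -1 then (p : ℂ) ^ 2 else 1 := by
    intro t ht
    have ht := Finset.ne_of_mem_erase ht
    by_cases h : t = 1 ∨ t = -1
    · simp only [h, if_true, Finset.prod_const_one]
      rw [if_neg]
      rcases h with rfl | rfl
      · rw [map_one]; norm_num
      · rw [chi_neg_one hp4]; norm_num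
    · simp only [h, if_false]
      push Not at h
      exact prod_TT hp4 hpn t ht h.1 h.2
  rw [Finset.prod_congr rfl e3, ← Finset.prod_filter, Finset.prod_const, card_nonres hp4 hpn, pow_mul]

lemma psi_conj {p : ℕ} [Fact p.Prime] (u : ZMod p) : (starRingEnd ℂ) (psi p u) = psi p (-u) := by
  rw [AddChar.map_neg_eq_conj]

lemma TT_real {p : ℕ} [Fact p.Prime] (u : ZMod p) : ∃ r : ℝ, TT p u = r := by
  rw [← Complex.conj_eq_iff_real, TT, map_mul, cc, map_add, psi_conj, psi_conj, neg_neg, add_comm]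
  congr 1
  simp [chi]

lemma D_val {p n : ℕ} [Fact p.Prime] (hp4 : p % 4 = 1) (hpn : p = 2 * n + 1) :
    (∏ i : Fin n, ∏ j ∈ univ.erase i, (TT p (hsys p n i) + TT p (hsys p n j))) = (p : ℂ) ^ (n / 2) := by
  have h4 := D_pow4 hp4 hpn
  choose r hr using fun u : ZMod p => TT_real u
  rw [prod_offdiag_split] at h4 ⊢
  have : ∏ i : Fin n, ∏ j ∈ Ioi i, ((TT p (hsys p n i) + TT p (hsys p n j)) *
      (TT p (hsys p n j) + TT p (hsys p n i))) = ((∏ i : Fin n, ∏ j ∈ Ioi i,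
        (r (hsys p n i) + r (hsys p n j)) ^ 2 : ℝ) : ℂ) := by
    simp only [hr]
    push_cast
    refine Finset.prod_congr rfl fun i _ => Finset.prod_congr rfl fun j _ => by ring
  rw [this] at h4 ⊢
  have hnn : 0 ≤ ∏ i : Fin n, ∏ j ∈ Ioi i, (r (hsys p n i) + r (hsys p n j)) ^ 2 :=
    Finset.prod_nonneg fun i _ => Finset.prod_nonneg fun j _ => sq_nonneg _
  generalize ∏ i : Fin n, ∏ j ∈ Ioi i, (r (hsys p n i) + r (hsys p n j)) ^ 2 = d at *
  have h5 : d ^ 4 = ((p : ℝ) ^ (n / 2)) ^ 4 := by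
    rw [← pow_mul]
    have : n / 2 * 4 = 2 * n := by omega
    rw [this]
    exact_mod_cast h4
  have h6 := (pow_left_inj₀ hnn (by positivity) (by norm_num : 4 ≠ 0)).1 h5
  rw [h6]; push_cast; rfl

lemma kap_pow {p n : ℕ} [Fact p.Prime] (hp4 : p % 4 = 1) (hpn : p = 2 * n + 1) :
    kap p n ^ n = (p : ℂ) ^ (n / 2) * (∏ i, xx p n i) ^ (2 * n) := by
  obtain ⟨k, hk⟩ : ∃ k, n = 2 * k := ⟨n / 2, by omega⟩
  have h2 : n / 2 = k := by omega
  rw [h2, kap, Finset.prod_pow]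
  generalize (∏ i, xx p n i) = X
  have e : (chi p 2 * (p * X ^ 2) / gs p) ^ 2 = p * (X ^ 2) ^ 2 := by
    rw [div_pow, mul_pow, chi_sq _ (two_ne_zmod hp4), gs_sq hp4]
    have h3 : (p : ℂ) ≠ 0 := (Nat.cast_ne_zero.2 (Nat.Prime.ne_zero Fact.out))
    field_simp
  rw [hk, pow_mul, e, mul_pow]
  congr 1
  rw [← pow_mul, ← pow_mul]

lemma fact_sq {p n : ℕ} [Fact p.Prime] (hp4 : p % 4 = 1) (hpn : p = 2 * n + 1) :
    (∏ i, hsys p n i) ^ 2 = (-1 : ZMod p) := by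
  have hn : Even n := ⟨n / 2, by omega⟩
  have h := prod_erase_range (m := 2 * n) hpn (fun u : ZMod p => u)
  have hw := ZMod.wilsons_lemma p
  have e : ∏ k ∈ range (2 * n), ((k + 1 : ℕ) : ZMod p) = -1 := by
    rw [← hw, ← Nat.cast_prod, Finset.prod_range_add_one_eq_factorial]
    congr 2; omega
  rw [e, prod_half hpn] at h
  rw [← h, ← Finset.prod_pow]
  have : ∏ i : Fin n, (hsys p n i * -hsys p n i) = ∏ i : Fin n, (-1 * hsys p n i ^ 2) :=
    Finset.prod_congr rfl fun i _ => by ring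
  rw [this, Finset.prod_mul_distrib, Finset.prod_const, Finset.card_univ, Fintype.card_fin,
    hn.neg_one_pow, one_mul]

lemma quad_of_zmod {p : ℕ} [Fact p.Prime] (hp4 : p % 4 = 1) (u : ZMod p) (hu : u ≠ 0) (k : ℕ)
    (h : u ^ (p / 2) = (-1) ^ k) : quadraticChar (ZMod p) u = (-1) ^ k := by
  have h2 : ringChar (ZMod p) ≠ 2 := by rw [ZMod.ringChar_zmod_n]; rintro rfl; omega
  have e := quadraticChar_eq_pow_of_char_ne_two' h2 u
  rw [ZMod.card, h] at e
  have hne : (1 : ZMod p) ≠ -1 := by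
    intro h; apply two_ne_zmod hp4; linear_combination h
  rcases Nat.even_or_odd k with hk | hk
  · rw [hk.neg_one_pow] at e ⊢
    rcases quadraticChar_dichotomy hu with h | h
    · exact h
    · rw [h] at e; push_cast at e; exact absurd e.symm hne
  · rw [hk.neg_one_pow] at e ⊢
    rcases quadraticChar_dichotomy hu with h | h
    · rw [h] at e; push_cast at e; exact absurd e hne
    · exact h

lemma prod_chi_half {p n : ℕ} [Fact p.Prime] (hp4 : p % 4 = 1) (hpn : p = 2 * n + 1) :
    ∏ i, chi p (hsys p n i) = (-1) ^ (n / 2) := by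
  rw [← map_prod]
  have h := fact_sq hp4 hpn
  have : quadraticChar (ZMod p) (∏ i, hsys p n i) = (-1) ^ (n / 2) := by
    apply quad_of_zmod hp4
    · exact Finset.prod_ne_zero_iff.2 fun i _ => hsys_ne_zero hpn i
    · have : p / 2 = 2 * (n / 2) := by omega
      rw [this, pow_mul, h]
  rw [chi, MulChar.ringHomComp_apply, this]; simp

lemma chi_two {p n : ℕ} [Fact p.Prime] (hp4 : p % 4 = 1) (hpn : p = 2 * n + 1) :
    chi p 2 = (-1) ^ (n / 2) := by
  have h2 : p ≠ 2 := by rintro rfl; omega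
  have h := legendreSym.at_two (p := p) h2
  have h3 := chi_legendre (p := p) 2
  rw [h, ZMod.χ₈_nat_eq_if_mod_eight] at h3
  have h4 : chi p ((2 : ℤ) : ZMod p) = chi p 2 := by simp
  rw [← h4, h3]
  rcases (show p % 8 = 1 ∨ p % 8 = 5 by omega) with h | h
  · have : Even (n / 2) := ⟨n / 4, by omega⟩
    rw [this.neg_one_pow]
    have : ¬ p % 2 = 0 := by omega
    simp [h, this]
  · have : Odd (n / 2) := ⟨n / 4, by omega⟩
    rw [this.neg_one_pow]
    have : ¬ p % 2 = 0 := by omega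
    simp [h, this]

lemma cc_cos {p : ℕ} [Fact p.Prime] (k : ℕ) :
    cc p (k : ZMod p) = ((2 * Real.cos (2 * Real.pi * k / p) : ℝ) : ℂ) := by
  have h1 := ZMod.stdAddChar_coe (N := p) k
  rw [cc, AddChar.map_neg_eq_inv]
  have h2 : psi p (k : ZMod p) = Complex.exp ((2 * Real.pi * k / p : ℝ) * Complex.I) := by
    have h1 : psi p (k : ZMod p) = Complex.exp (2 * Real.pi * Complex.I * k / p) := by
      simpa using h1
    rw [h1]; congr 1; push_cast; ring
  rw [h2, ← Complex.exp_neg]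
  push_cast
  rw [Complex.two_cos]
  congr 2; ring

lemma prod_cc_half {p n : ℕ} [Fact p.Prime] (hp4 : p % 4 = 1) (hpn : p = 2 * n + 1) :
    ∏ i, cc p (hsys p n i) = (-1) ^ (n / 2) := by
  obtain ⟨k, hk⟩ : ∃ k, n = k + k := ⟨n / 2, by omega⟩
  have hk2 : n / 2 = k := by omega
  have hsq : (∏ i, cc p (hsys p n i)) ^ 2 = 1 := by
    have h1 := prod_half hpn (fun u => cc p u)
    have h2 : ∀ u, cc p (-u) = cc p u := fun u => by rw [cc, cc, neg_neg, add_comm]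
    simp only [h2, Finset.prod_mul_distrib] at h1
    rw [pow_two, ← h1]
    have two := two_ne_zmod hp4
    have e1 : ∀ u, cc p u = psi p (-1 * u) * (1 + psi p (2 * u)) := by
      intro u
      rw [mul_add, ← AddChar.map_add_eq_mul, cc, mul_one, add_comm]
      congr 2 <;> ring
    have e2 : ∀ u, 1 - psi p ((2 * 2) * u) = (1 - psi p (2 * u)) * (1 + psi p (2 * u)) := by
      intro u
      have : psi p ((2 * 2) * u) = psi p (2 * u) ^ 2 := by
        rw [psi_pow]; congr 1; push_cast; ring
      rw [this]; ring
    have h3 := prod_one_sub_psi (p := p) (2 * 2) (mul_ne_zero two two)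
    simp only [e2, Finset.prod_mul_distrib] at h3
    rw [prod_one_sub_psi 2 two] at h3
    simp only [e1, Finset.prod_mul_distrib]
    rw [prod_psi hpn, one_mul]
    have hp : (p : ℂ) ≠ 0 := Nat.cast_ne_zero.2 (Nat.Prime.ne_zero Fact.out)
    exact mul_left_cancel₀ hp (by rw [h3, mul_one])
  set c : ℕ → ℝ := fun m => 2 * Real.cos (2 * Real.pi * (m + 1 : ℕ) / p) with hc
  have hprod : ∏ i, cc p (hsys p n i) = ((∏ m ∈ range n, c m : ℝ) : ℂ) := by
    push_cast
    rw [← Fin.prod_univ_eq_prod_range (fun m => (c m : ℂ))]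
    refine Finset.prod_congr rfl fun i _ => ?_
    rw [hsys, cc_cos]
  rw [hprod] at hsq ⊢
  have hp0 : (0 : ℝ) < p := by exact_mod_cast (Fact.out : p.Prime).pos
  have hpk : (p : ℝ) = 4 * k + 1 := by
    have : p = 4 * k + 1 := by omega
    rw [this]; push_cast; ring
  have hpi := Real.pi_pos
  have hpos : 0 < (-1) ^ k * ∏ m ∈ range n, c m := by
    rw [hk, Finset.prod_range_add]
    have a : 0 < ∏ m ∈ range k, c m := by
      refine Finset.prod_pos fun m hm => ?_
      have hm : (m : ℝ) + 1 ≤ k := by exact_mod_cast mem_range.1 hm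
      have : 0 < Real.cos (2 * Real.pi * (m + 1 : ℕ) / p) := by
        apply Real.cos_pos_of_mem_Ioo
        constructor
        · have : 0 ≤ 2 * Real.pi * (m + 1 : ℕ) / p := by positivity
          linarith
        · rw [div_lt_iff₀ hp0, hpk]; push_cast
          nlinarith
      simp only [hc]; linarith
    have b : 0 < ∏ m ∈ range k, (-1 * c (k + m)) := by
      refine Finset.prod_pos fun m hm => ?_
      have hm : (m : ℝ) + 1 ≤ k := by exact_mod_cast mem_range.1 hm
      have hm0 : (0 : ℝ) ≤ m := by positivity
      have : Real.cos (2 * Real.pi * (k + m + 1 : ℕ) / p) < 0 := by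
        apply Real.cos_neg_of_pi_div_two_lt_of_lt
        · rw [lt_div_iff₀ hp0, hpk]; push_cast
          nlinarith
        · rw [div_lt_iff₀ hp0, hpk]; push_cast
          nlinarith
      simp only [hc]; linarith
    rw [Finset.prod_mul_distrib, Finset.prod_const, card_range] at b
    have := mul_pos a b
    linarith
  have hsq' : (∏ m ∈ range n, c m) ^ 2 = 1 := by exact_mod_cast hsq
  have : ∏ m ∈ range n, c m = (-1) ^ k := by
    rcases neg_one_pow_eq_or ℝ k with h | h <;> rw [h] at hpos ⊢ <;> nlinarith
  rw [this, hk2]; push_cast; rfl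

lemma sum_TT {p n : ℕ} [Fact p.Prime] (hp4 : p % 4 = 1) (hpn : p = 2 * n + 1) :
    ∑ i, (xx p n i + (xx p n i)⁻¹) = gs p := by
  have h := sum_chi_psi hp4 1
  rw [sum_half hpn, map_one, one_mul] at h
  rw [← h]
  refine Finset.sum_congr rfl fun i _ => ?_
  rw [TT_xx hpn, TT, cc, chi_neg hp4, mul_one, mul_one]; ring

lemma dets {p n : ℕ} [Fact p.Prime] (hp4 : p % 4 = 1) (hpn : p = 2 * n + 1) :
    (Matrix.of fun j k : Fin n => chi p (((j : ℤ) - (k : ℤ) + 1 : ℤ) : ZMod p) -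
      chi p (((j : ℤ) - (k : ℤ) : ℤ) : ZMod p)).det = chi p 2 ∧
    (Matrix.of fun j k : Fin n => chi p (((j : ℤ) - (k : ℤ) + 1 : ℤ) : ZMod p)).det =
    chi p 2 * (∏ i, (1 - xx p n i ^ 2))⁻¹ * ((∏ i, xx p n i) / 2 *
      (((∏ i, (1 + xx p n i)) / (∏ i, (1 - xx p n i)) + (∏ i, (1 - xx p n i)) / (∏ i, (1 + xx p n i)))
       + gs p *
        ((∏ i, (1 - xx p n i)) / (∏ i, (1 + xx p n i)) - (∏ i, (1 + xx p n i)) / (∏ i, (1 - xx p n i))))) := by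
  have hn : Even n := ⟨n / 2, by omega⟩
  have two := two_ne_zmod hp4
  have h := abstract_dets hn (xx p n) (fun i => chi p (2 * hsys p n i) / gs p) (kap p n)
    (xx_ne_zero hpn) (by
      intro i l
      rw [xx_sq hpn, xx_sq hpn, ← AddChar.map_add_eq_mul, Ne, psi_eq_one_iff, ← mul_add]
      exact mul_ne_zero two (hsys_add_ne_zero hpn i l)) (by
      intro i
      rw [xx_sq hpn, Ne, psi_eq_one_iff]
      exact mul_ne_zero two (hsys_ne_zero hpn i)) (by
      intro i j hij
      simp only [xx_sq hpn] at hij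
      exact hsys_inj hpn (mul_left_cancel₀ two (ZMod.injective_stdAddChar hij)))
      (hs_hyp hp4 hpn) (fun m => chi p (m : ZMod p)) (chi_expand hp4 hpn)
  have hG : (Matrix.of fun j k : Fin n => chi p (((j : ℤ) - (k : ℤ) + 1 : ℤ) : ZMod p) -
      chi p (((j : ℤ) - (k : ℤ) : ℤ) : ZMod p)).det = chi p 2 := by
    rw [h.1, kap_pow hp4 hpn]
    simp only [TT_xx hpn]
    rw [D_val hp4 hpn]
    have : ∏ i, TT p (hsys p n i) = (-1) ^ (n / 2) * (-1) ^ (n / 2) := by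
      simp only [TT, Finset.prod_mul_distrib, prod_chi_half hp4 hpn, prod_cc_half hp4 hpn]
    rw [this, chi_two hp4 hpn]
    have h0 : ∏ i, xx p n i ≠ 0 := Finset.prod_ne_zero_iff.2 fun i _ => xx_ne_zero hpn i
    have h3 : (p : ℂ) ≠ 0 := (Nat.cast_ne_zero.2 (Nat.Prime.ne_zero Fact.out))
    rcases neg_one_pow_eq_or ℂ (n / 2) with h | h <;> rw [h] <;> field_simp
  refine ⟨hG, ?_⟩
  rw [h.2, hG, sum_TT hp4 hpn]

lemma prod_one_sub_sq {p n : ℕ} [Fact p.Prime] (hp4 : p % 4 = 1) (hpn : p = 2 * n + 1) :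
    (∏ i, (1 - xx p n i ^ 2)) ^ 2 = p * (∏ i, xx p n i) ^ 2 := by
  have hn : Even n := ⟨n / 2, by omega⟩
  have h := prod_one_sub_psi (p := p) 2 (two_ne_zmod hp4)
  rw [prod_half hpn] at h
  rw [← h, ← Finset.prod_pow, ← Finset.prod_pow, ← Finset.prod_mul_distrib]
  have e : ∀ i, (1 - xx p n i ^ 2) ^ 2 = -1 * ((1 - psi p (2 * hsys p n i)) *
      (1 - psi p (2 * -hsys p n i)) * xx p n i ^ 2) := by
    intro i
    rw [xx_sq hpn, mul_neg, AddChar.map_neg_eq_inv]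
    have := psi_ne_zero (2 * hsys p n i)
    field_simp
    ring
  simp only [e]
  rw [Finset.prod_mul_distrib, Finset.prod_const, Finset.card_univ, Fintype.card_fin, hn.neg_one_pow,
    one_mul]

lemma prod_xx {p n : ℕ} [Fact p.Prime] (hp4 : p % 4 = 1) (hpn : p = 2 * n + 1) :
    ∏ i, xx p n i = (-1) ^ (n / 2) * psi p 1 ^ (n * (n + 1) / 2) := by
  simp only [xx, Finset.prod_mul_distrib, prod_chi_half hp4 hpn]
  simp only [hsys, psi_natCast]
  congr 1
  rw [Fin.prod_univ_eq_prod_range (fun i => psi p 1 ^ (i + 1)), Finset.prod_pow_eq_pow_sum]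
  congr 1
  have := Finset.sum_range_succ' (fun i => i) n
  simp only [add_zero] at this
  rw [← this, Finset.sum_range_id, mul_comm]
  simp

/-- value at `ρ = 0` -/
lemma det_zero {p n : ℕ} [Fact p.Prime] (hp4 : p % 4 = 1) (hpn : p = 2 * n + 1)
    (A B : ℂ)
    (hAB1 : ∏ i : Fin n, (1 + (xx p n i)⁻¹) ^ 2
        = (∏ i, xx p n i)⁻¹ * (B * p + A * gs p))
    (hAB2 : ∏ i : Fin n, (1 - (xx p n i)⁻¹) ^ 2
        = (∏ i, xx p n i)⁻¹ * (B * p - A * gs p)) :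
    (Matrix.of fun j k : Fin n => chi p (((j : ℤ) - (k : ℤ) + 1 : ℤ) : ZMod p)).det =
      chi p 2 * (B - A) := by
  have hn : Even n := ⟨n / 2, by omega⟩
  rw [(dets hp4 hpn).2]
  have hX : ∏ i, xx p n i ≠ 0 := Finset.prod_ne_zero_iff.2 fun i _ => xx_ne_zero hpn i
  have e1 : ∏ i : Fin n, (1 + (xx p n i)⁻¹) ^ 2 = (∏ i, (1 + xx p n i)) ^ 2 / (∏ i, xx p n i) ^ 2 := by
    rw [← Finset.prod_pow, ← Finset.prod_pow, ← Finset.prod_div_distrib]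
    refine Finset.prod_congr rfl fun i _ => ?_
    have := xx_ne_zero hpn i
    field_simp
    ring
  have e2 : ∏ i : Fin n, (1 - (xx p n i)⁻¹) ^ 2 = (∏ i, (1 - xx p n i)) ^ 2 / (∏ i, xx p n i) ^ 2 := by
    rw [← Finset.prod_pow, ← Finset.prod_pow, ← Finset.prod_div_distrib]
    refine Finset.prod_congr rfl fun i _ => ?_
    have := xx_ne_zero hpn i
    field_simp
    ring
  have e3 : ∏ i, (1 - xx p n i ^ 2) = (∏ i, (1 + xx p n i)) * ∏ i, (1 - xx p n i) := by
    rw [← Finset.prod_mul_distrib]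
    exact Finset.prod_congr rfl fun i _ => by ring
  have e4 := prod_one_sub_sq hp4 hpn
  have h3 : (p : ℂ) ≠ 0 := (Nat.cast_ne_zero.2 (Nat.Prime.ne_zero Fact.out))
  have hg := gs_sq hp4
  rw [e1] at hAB1
  rw [e2] at hAB2
  rw [e3] at e4 ⊢
  have hne : (∏ i, (1 + xx p n i)) * ∏ i, (1 - xx p n i) ≠ 0 := by
    intro h; rw [h] at e4
    exact mul_ne_zero h3 (pow_ne_zero 2 hX) (by rw [← e4]; norm_num)
  have hU := left_ne_zero_of_mul hne
  have hV := right_ne_zero_of_mul hne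
  generalize ∏ i, (1 + xx p n i) = U at *
  generalize ∏ i, (1 - xx p n i) = V at *
  generalize ∏ i, xx p n i = X at *
  generalize gs p = g at *
  rw [div_eq_iff (pow_ne_zero 2 hX)] at hAB1 hAB2
  have f1 : U ^ 2 = X * (B * p + A * g) := by rw [hAB1]; field_simp
  have f2 : V ^ 2 = X * (B * p - A * g) := by rw [hAB2]; field_simp
  have f3 : (U * V)⁻¹ * (X / 2 * (U / V + V / U + g * (V / U - U / V))) =
      X * (U ^ 2 + V ^ 2 + g * (V ^ 2 - U ^ 2)) / (2 * (U * V) ^ 2) := by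
    field_simp
  rw [mul_assoc, f3, e4, f1, f2]
  congr 1
  field_simp
  linear_combination (-2 * A) * hg

lemma dvd_of_psi_root {p : ℕ} [Fact p.Prime] (f : Polynomial ℤ)
    (hf : Polynomial.aeval (psi p 1) f = 0) : Polynomial.cyclotomic p ℤ ∣ f := by
  have h := psi_prim (p := p)
  have hpos := (Fact.out : p.Prime).pos
  rw [Polynomial.cyclotomic_eq_minpoly h hpos]
  exact minpoly.isIntegrallyClosed_dvd (h.isIntegral hpos) hf

lemma cyclo_mod {p : ℕ} [Fact p.Prime] :
    (Polynomial.cyclotomic p (ZMod p)) = (Polynomial.X - 1) ^ (p - 1) := by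
  have h1 := Polynomial.cyclotomic_prime_mul_X_sub_one (ZMod p) p
  have h2 : (Polynomial.X - 1 : Polynomial (ZMod p)) ^ p = Polynomial.X ^ p - 1 := by
    rw [sub_pow_char]; simp
  have h3 : (Polynomial.X - 1 : Polynomial (ZMod p)) ≠ 0 := by
    have := Polynomial.X_sub_C_ne_zero (1 : ZMod p); simpa using this
  apply mul_right_cancel₀ h3
  rw [h1, ← h2, ← pow_succ, Nat.sub_add_cancel (Fact.out : p.Prime).one_le]

lemma coeff_zero_of_root {p n : ℕ} [Fact p.Prime] (hpn : p = 2 * n + 1) (f : Polynomial ℤ)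
    (hf : Polynomial.aeval (psi p 1) f = 0) :
    ((f.map (Int.castRingHom (ZMod p))).comp (Polynomial.X + 1)).coeff n = 0 := by
  obtain ⟨q, hq⟩ := dvd_of_psi_root f hf
  rw [hq, Polynomial.map_mul, Polynomial.map_cyclotomic, cyclo_mod, Polynomial.mul_comp,
    Polynomial.pow_comp, Polynomial.sub_comp, Polynomial.X_comp, Polynomial.one_comp,
    add_sub_cancel_right, Polynomial.coeff_X_pow_mul']
  have hp := (Fact.out : p.Prime).two_le
  rw [if_neg (by omega)]

lemma sum_poly {p : ℕ} [Fact p.Prime] (P : Polynomial (ZMod p)) (hm : P.Monic)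
    (hd : P.natDegree = p - 1) : ∑ u, P.eval u = -1 := by
  have hp := (Fact.out : p.Prime).two_le
  simp only [Polynomial.eval_eq_sum_range]
  rw [Finset.sum_comm, Finset.sum_range_succ, hd, Finset.sum_eq_zero, zero_add]
  · have : P.coeff (p - 1) = 1 := by rw [← hd]; exact hm
    simp only [this, one_mul]
    have e : ∀ u : ZMod p, u ^ (p - 1) = 1 - if u = 0 then 1 else 0 := by
      intro u
      by_cases h : u = 0
      · rw [if_pos h, h, zero_pow (by omega)]; ring
      · rw [if_neg h, ZMod.pow_card_sub_one_eq_one h]; ring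
    simp only [e]
    simp
  · intro i hi
    rw [← Finset.mul_sum]
    have : ∑ u : ZMod p, u ^ i = 0 := by
      apply FiniteField.sum_pow_lt_card_sub_one
      rw [ZMod.card]; simpa using hi
    rw [this, mul_zero]

lemma coeff_prod_diff {R : Type*} [CommRing R] {n : ℕ} (a b : Fin n → ℕ) :
    (∏ i, ((Polynomial.X + 1 : Polynomial R) ^ a i - (Polynomial.X + 1) ^ b i)).coeff n =
      ∏ i, ((a i : R) - b i) := by
  have h : ∀ m : ℕ, ∃ q : Polynomial R, (Polynomial.X + 1) ^ m = Polynomial.X * q + 1 ∧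
      q.coeff 0 = m := by
    intro m
    induction m with
    | zero => exact ⟨0, by simp, by simp⟩
    | succ m ih =>
      obtain ⟨q, h1, h2⟩ := ih
      refine ⟨q * (Polynomial.X + 1) + 1, ?_, ?_⟩
      · rw [pow_succ, h1]; ring
      · simp [mul_add, h2]
  choose q h1 h2 using h
  have e : ∀ i, ((Polynomial.X + 1 : Polynomial R) ^ a i - (Polynomial.X + 1) ^ b i) =
      Polynomial.X * (q (a i) - q (b i)) := by
    intro i; rw [h1, h1]; ring
  simp only [e, Finset.prod_mul_distrib, Finset.prod_const, Finset.card_univ, Fintype.card_fin]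
  have := Polynomial.coeff_X_pow_mul (∏ i, (q (a i) - q (b i))) n 0
  rw [zero_add] at this
  rw [this, Polynomial.coeff_zero_eq_eval_zero, Polynomial.eval_prod]
  refine Finset.prod_congr rfl fun i _ => ?_
  rw [Polynomial.eval_sub, ← Polynomial.coeff_zero_eq_eval_zero, ← Polynomial.coeff_zero_eq_eval_zero,
    h2, h2]

lemma quad_pow {p n : ℕ} [Fact p.Prime] (hp4 : p % 4 = 1) (hpn : p = 2 * n + 1) (u : ZMod p) :
    ((quadraticChar (ZMod p) u : ℤ) : ZMod p) = u ^ n := by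
  have h2 : ringChar (ZMod p) ≠ 2 := by rw [ZMod.ringChar_zmod_n]; rintro rfl; omega
  have e := quadraticChar_eq_pow_of_char_ne_two' h2 u
  rw [e, ZMod.card]; congr 1; omega

lemma gs_mod {p n : ℕ} [Fact p.Prime] (hp4 : p % 4 = 1) (hpn : p = 2 * n + 1) (e : ℤ)
    (h : gs p = e * ∏ i, (psi p (hsys p n i) - psi p (-hsys p n i))) :
    (e : ZMod p) * 2 ^ n = 1 := by
  have hp := (Fact.out : p.Prime).two_le
  set F : Polynomial ℤ := ∑ j ∈ range p, Polynomial.C (quadraticChar (ZMod p) (j : ZMod p)) *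
    Polynomial.X ^ j with hF
  set R : Polynomial ℤ := ∏ i : Fin n, (Polynomial.X ^ ((i : ℕ) + 1) -
    Polynomial.X ^ (p - ((i : ℕ) + 1))) with hR
  have hroot : Polynomial.aeval (psi p 1) (F - Polynomial.C e * R) = 0 := by
    rw [map_sub, map_mul, sub_eq_zero, hF, hR, map_sum, map_prod]
    simp only [map_mul, map_sub, map_pow, Polynomial.aeval_X, Polynomial.aeval_C]
    have a : ∑ j ∈ range p, (algebraMap ℤ ℂ) (quadraticChar (ZMod p) (j : ZMod p)) * psi p 1 ^ j
        = gs p := by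
      rw [gs, gaussSum]
      have := prod_zmod_range (p := p) (M := Multiplicative ℂ) (fun u => chi p u * psi p u)
      refine Eq.trans ?_ this.symm
      refine Finset.sum_congr rfl fun j _ => ?_
      rw [← psi_natCast]; rfl
    rw [a, h]
    congr 1
    refine Finset.prod_congr rfl fun i _ => ?_
    rw [← psi_natCast, ← psi_natCast, hsys, Nat.cast_sub (by omega)]
    simp
  have hc := coeff_zero_of_root hpn _ hroot
  rw [Polynomial.map_sub, Polynomial.map_mul, Polynomial.map_C, Polynomial.sub_comp, Polynomial.mul_comp,
    Polynomial.C_comp, Polynomial.coeff_sub, Polynomial.coeff_C_mul, sub_eq_zero] at hc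
  have hRc : ((R.map (Int.castRingHom (ZMod p))).comp (Polynomial.X + 1)).coeff n =
      2 ^ n * ∏ i, hsys p n i := by
    rw [hR, Polynomial.map_prod, Polynomial.prod_comp]
    simp only [Polynomial.map_sub, Polynomial.map_pow, Polynomial.map_X, Polynomial.sub_comp,
      Polynomial.pow_comp, Polynomial.X_comp]
    rw [coeff_prod_diff]
    have : (2 : ZMod p) ^ n = ∏ i : Fin n, 2 := by simp
    rw [this, ← Finset.prod_mul_distrib]
    refine Finset.prod_congr rfl fun i _ => ?_
    rw [hsys, Nat.cast_sub (by omega)]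
    simp; ring
  have hFc : (n.factorial : ZMod p) * ((F.map (Int.castRingHom (ZMod p))).comp (Polynomial.X + 1)).coeff n =
      -1 := by
    rw [hF, Polynomial.map_sum, Polynomial.sum_comp, Polynomial.finsetSum_coeff, Finset.mul_sum]
    rw [← sum_poly (Polynomial.X ^ n * descPochhammer (ZMod p) n)
      ((Polynomial.monic_X_pow n).mul (monic_descPochhammer _ n)) (by
        rw [Polynomial.Monic.natDegree_mul (Polynomial.monic_X_pow n) (monic_descPochhammer _ n),
          Polynomial.natDegree_X_pow, descPochhammer_natDegree]; omega)]
    set ev : ZMod p → ZMod p := fun u => (Polynomial.X ^ n * descPochhammer (ZMod p) n).eval u with hev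
    have := prod_zmod_range (p := p) (M := Multiplicative (ZMod p)) ev
    refine Eq.trans ?_ this.symm
    refine Finset.sum_congr rfl fun j _ => ?_
    change _ = ev (j : ZMod p)
    rw [hev]
    simp only [Polynomial.map_mul, Polynomial.map_C, Polynomial.map_pow, Polynomial.map_X,
      Polynomial.mul_comp, Polynomial.C_comp, Polynomial.pow_comp, Polynomial.X_comp,
      Polynomial.coeff_C_mul, Polynomial.coeff_X_add_one_pow, Polynomial.eval_mul,
      Polynomial.eval_pow, Polynomial.eval_X, descPochhammer_eval_eq_descFactorial,
      Nat.descFactorial_eq_factorial_mul_choose]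
    rw [eq_intCast, quad_pow hp4 hpn]
    push_cast
    ring
  have hfact : (n.factorial : ZMod p) = ∏ i, hsys p n i := by
    rw [← Finset.prod_range_add_one_eq_factorial, Nat.cast_prod]
    exact (Fin.prod_univ_eq_prod_range (fun i => ((i + 1 : ℕ) : ZMod p)) n).symm
  rw [hc, hRc, hfact] at hFc
  have := fact_sq hp4 hpn
  rw [eq_intCast] at hFc
  linear_combination (-1) * hFc + (e : ZMod p) * 2 ^ n * this

lemma gs_sign {p n : ℕ} [Fact p.Prime] (hp4 : p % 4 = 1) (hpn : p = 2 * n + 1) :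
    gs p = ((Real.sqrt p : ℝ) : ℂ) := by
  have hn : Even n := ⟨n / 2, by omega⟩
  set R := ∏ i, (psi p (hsys p n i) - psi p (-hsys p n i)) with hR
  have two := two_ne_zmod hp4
  have hRsq : R ^ 2 = p := by
    have h := prod_half hpn (fun u => psi p u - psi p (-u))
    have e1 : ∀ u, psi p u - psi p (-u) = psi p (1 * u) * (1 - psi p (-2 * u)) := by
      intro u
      rw [mul_sub, ← AddChar.map_add_eq_mul, mul_one, one_mul]
      congr 2; ring
    simp only [neg_neg] at h
    have e2 : ∀ i, (psi p (hsys p n i) - psi p (-hsys p n i)) * (psi p (-hsys p n i) - psi p (hsys p n i))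
        = -1 * (psi p (hsys p n i) - psi p (-hsys p n i)) ^ 2 := fun i => by ring
    simp only [e2, Finset.prod_mul_distrib, Finset.prod_const, Finset.card_univ, Fintype.card_fin,
      hn.neg_one_pow, one_mul, Finset.prod_pow] at h
    rw [← hR] at h
    rw [← h]
    simp only [e1, Finset.prod_mul_distrib]
    rw [prod_psi hpn, prod_one_sub_psi _ (neg_ne_zero.2 two), one_mul]
  have hp0 : (0 : ℝ) < p := by exact_mod_cast (Fact.out : p.Prime).pos
  -- R = (-1)^(n/2) Q
  set Q : ℝ := ∏ i : Fin n, (2 * Real.sin (2 * Real.pi * ((i : ℕ) + 1 : ℕ) / p)) with hQ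
  have hQpos : 0 < Q := by
    refine Finset.prod_pos fun i _ => ?_
    have : 0 < Real.sin (2 * Real.pi * ((i : ℕ) + 1 : ℕ) / p) := by
      have hpi := Real.pi_pos
      apply Real.sin_pos_of_pos_of_lt_pi
      · positivity
      · rw [div_lt_iff₀ hp0]
        have : (2 * (((i : ℕ) + 1 : ℕ) : ℝ)) < p := by
          have : 2 * ((i : ℕ) + 1) < p := by omega
          exact_mod_cast this
        nlinarith
    linarith
  have hRQ : R = (-1) ^ (n / 2) * (Q : ℂ) := by
    have e : ∀ i : Fin n, psi p (hsys p n i) - psi p (-hsys p n i) =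
        Complex.I * ((2 * Real.sin (2 * Real.pi * ((i : ℕ) + 1 : ℕ) / p) : ℝ) : ℂ) := by
      intro i
      have h1 := ZMod.stdAddChar_coe (N := p) (((i : ℕ) + 1 : ℕ) : ℤ)
      have h2 : psi p (hsys p n i) = Complex.exp ((2 * Real.pi * ((i : ℕ) + 1 : ℕ) / p : ℝ) * Complex.I) := by
        have h1 : psi p (hsys p n i) = Complex.exp (2 * Real.pi * Complex.I * ((i : ℕ) + 1 : ℕ) / p) := by
          rw [hsys]; simpa using h1
        rw [h1]; congr 1; push_cast; ring
      rw [AddChar.map_neg_eq_inv, h2, ← Complex.exp_neg, ← neg_mul]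
      rw [Complex.ofReal_mul, Complex.ofReal_sin]
      have := Complex.two_sin (((2 * Real.pi * ((i : ℕ) + 1 : ℕ) / p : ℝ)) : ℂ)
      push_cast at this ⊢
      rw [this]
      ring_nf
      simp
      ring
    rw [hR]
    simp only [e, Finset.prod_mul_distrib, Finset.prod_const, Finset.card_univ, Fintype.card_fin]
    rw [hQ, Complex.ofReal_prod]
    congr 1
    have : n = 2 * (n / 2) := by omega
    conv_lhs => rw [this]
    rw [pow_mul, Complex.I_sq]
  have hQs : Q = Real.sqrt p := by
    symm
    rw [Real.sqrt_eq_iff_eq_sq hp0.le hQpos.le]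
    have : (p : ℂ) = ((Q ^ 2 : ℝ) : ℂ) := by
      rw [← hRsq, hRQ, mul_pow, ← pow_mul, mul_comm _ 2, pow_mul]; simp
    exact_mod_cast this
  have hcases : ∃ k : ℕ, gs p = ((-1 : ℤ) ^ k : ℤ) * R := by
    have : gs p ^ 2 = R ^ 2 := by rw [hRsq, gs_sq hp4]
    rcases sq_eq_sq_iff_eq_or_eq_neg.1 this with h | h
    · exact ⟨0, by simpa using h⟩
    · exact ⟨1, by simpa using h⟩
  obtain ⟨k, hk⟩ := hcases
  have hm := gs_mod hp4 hpn _ hk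
  have h2n : (2 : ZMod p) ^ n = (-1) ^ k := by
    push_cast at hm
    rcases neg_one_pow_eq_or (ZMod p) k with h | h <;> rw [h] at hm ⊢
    · simpa using hm
    · linear_combination -hm
  have hq := quad_of_zmod hp4 2 two k (by rw [← h2n]; congr 1; omega)
  have hc : chi p 2 = (-1) ^ k := by
    rw [chi, MulChar.ringHomComp_apply, hq]; simp
  rw [chi_two hp4 hpn] at hc
  rw [hk, hRQ, hQs, hc, ← mul_assoc]
  push_cast
  rw [← mul_pow]; simp

lemma lower_ones_mul {n : ℕ} (a : ℤ → ℝ) (ha : ∀ m, a (-m) = a m) :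
    (Matrix.of fun j k : Fin n => a ((j : ℤ) - (k : ℤ) + 1) - a (k : ℤ)).det =
    (Matrix.of fun j k : Fin n => a ((j : ℤ) - (k : ℤ) + 1) - a ((j : ℤ) - (k : ℤ))).det := by
  set T : Matrix (Fin n) (Fin n) ℝ := Matrix.of fun j k => if k ≤ j then 1 else 0 with hT
  have hdet : T.det = 1 := by
    rw [Matrix.det_of_isLowerTriangular]
    · simp [hT]
    · intro i j hij
      have : i < j := by simpa using hij
      simp [hT, not_le.2 this]
  have : (Matrix.of fun j k : Fin n => a ((j : ℤ) - (k : ℤ) + 1) - a (k : ℤ)) =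
    T * (Matrix.of fun j k : Fin n => a ((j : ℤ) - (k : ℤ) + 1) - a ((j : ℤ) - (k : ℤ))) := by
    ext j k
    simp only [Matrix.mul_apply, hT, Matrix.of_apply, ite_mul, one_mul, zero_mul]
    have e : ∑ x : Fin n, (if x ≤ j then a ((x : ℤ) - (k : ℤ) + 1) - a ((x : ℤ) - (k : ℤ)) else 0) =
        ∑ x ∈ range n, (if x ≤ (j : ℕ) then a ((x : ℤ) - (k : ℤ) + 1) - a ((x : ℤ) - (k : ℤ)) else 0) := by
      rw [← Fin.sum_univ_eq_sum_range (fun x => if x ≤ (j : ℕ) then a ((x : ℤ) - (k : ℤ) + 1) - a ((x : ℤ) - (k : ℤ)) else 0)]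
      rfl
    rw [e, ← Finset.sum_filter]
    have e2 : (range n).filter (fun x => x ≤ (j : ℕ)) = range ((j : ℕ) + 1) := by
      ext x; simp; omega
    rw [e2]
    have := Finset.sum_range_sub (fun x : ℕ => a ((x : ℤ) - (k : ℤ))) ((j : ℕ) + 1)
    have e3 : ∀ x : ℕ, ((x : ℤ) - (k : ℤ) + 1) = ((x + 1 : ℕ) : ℤ) - (k : ℤ) := by
      intro x; push_cast; ring
    simp only [e3]
    rw [this]
    simp [ha]
  rw [this, det_mul, hdet, one_mul]

lemma det_affine {n : ℕ} (M : Matrix (Fin n) (Fin n) ℝ) (hM : M.det ≠ 0) (v : Fin n → ℝ) :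
    ∃ c : ℝ, ∀ ρ : ℝ, (Matrix.of fun j k => M j k + ρ * v k).det = M.det + ρ * c := by
  refine ⟨M.det * (∑ i, v i * (M⁻¹ *ᵥ fun _ => (1 : ℝ)) i), fun ρ => ?_⟩
  have e1 : (Matrix.of fun j k => M j k + ρ * v k) =
      M * (1 + replicateCol Unit (M⁻¹ *ᵥ fun _ => (1 : ℝ)) * replicateRow Unit (fun k => ρ * v k)) := by
    rw [Matrix.mul_add, Matrix.mul_one, ← Matrix.mul_assoc, ← replicateCol_mulVec,
      Matrix.mulVec_mulVec, Matrix.mul_nonsing_inv _ hM.isUnit, Matrix.one_mulVec]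
    ext j k
    simp [Matrix.mul_apply]
  rw [e1, det_mul, det_one_add_replicateCol_mul_replicateRow, dotProduct, mul_add, mul_one]
  have : ∑ i, ρ * v i * (M⁻¹ *ᵥ fun _ => (1 : ℝ)) i = ρ * ∑ i, v i * (M⁻¹ *ᵥ fun _ => (1 : ℝ)) i := by
    rw [Finset.mul_sum]
    exact Finset.sum_congr rfl fun i _ => by ring
  rw [this]; ring

/-- `F(ρ) = det[χ(j-k+1) + ρχ(k)] = L((B - A) + (B - A - 1)ρ)`. -/
theorem stmt_4 (p : ℕ) [Fact p.Prime] (hp4 : p % 4 = 1)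
    (n : ℕ) (hn : n = (p - 1) / 2)
    (ζ : ℂ) (hζ : ζ = Complex.exp (2 * Real.pi * Complex.I / p))
    (A B : ℝ) (hBA : B ≠ A)
    (hAB1 : ∏ r ∈ Finset.Icc 1 n, (1 + (legendreSym p (r : ℤ) : ℂ) * ζ ^ (-(r : ℤ))) ^ 2
        = (-1 : ℂ) ^ (n / 2) * ζ ^ (-((n * (n + 1) / 2 : ℕ) : ℤ))
          * ((B : ℂ) * (p : ℂ) + (A : ℂ) * ((Real.sqrt p : ℝ) : ℂ)))
    (hAB2 : ∏ r ∈ Finset.Icc 1 n, (1 - (legendreSym p (r : ℤ) : ℂ) * ζ ^ (-(r : ℤ))) ^ 2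
        = (-1 : ℂ) ^ (n / 2) * ζ ^ (-((n * (n + 1) / 2 : ℕ) : ℤ))
          * ((B : ℂ) * (p : ℂ) - (A : ℂ) * ((Real.sqrt p : ℝ) : ℂ)))
    (L : ℝ) (hL : L = (legendreSym p 2 : ℝ))
    (ρ : ℝ) :
    (Matrix.of fun j k : Fin n =>
        (legendreSym p (((j : ℕ) : ℤ) - ((k : ℕ) : ℤ) + 1) : ℝ)
          + ρ * (legendreSym p ((k : ℕ) : ℤ) : ℝ)).det
      = L * ((B - A) + (B - A - 1) * ρ) := by
  have hpn : p = 2 * n + 1 := by omega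
  have hz : ζ = psi p 1 := by
    rw [hζ]
    have := ZMod.stdAddChar_coe (N := p) 1
    simpa using this.symm
  have hz0 : psi p 1 ≠ 0 := psi_ne_zero 1
  have hgs := gs_sign hp4 hpn
  have hXinv : (-1 : ℂ) ^ (n / 2) * ζ ^ (-((n * (n + 1) / 2 : ℕ) : ℤ)) = (∏ i, xx p n i)⁻¹ := by
    rw [prod_xx hp4 hpn, hz, _root_.zpow_neg, zpow_natCast, mul_inv]
    congr 1
    rcases neg_one_pow_eq_or ℂ (n / 2) with h | h <;> rw [h] <;> norm_num
  have hx : ∀ i : Fin n, (xx p n i)⁻¹ = (legendreSym p (((i : ℕ) + 1 : ℕ) : ℤ) : ℂ) *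
      ζ ^ (-(((i : ℕ) + 1 : ℕ) : ℤ)) := by
    intro i
    have : (chi p (hsys p n i))⁻¹ = chi p (hsys p n i) := by
      rcases chi_cases (hsys p n i) (hsys_ne_zero hpn i) with h | h <;> rw [h] <;> norm_num
    rw [xx, mul_inv, this, hz, _root_.zpow_neg, zpow_natCast, ← chi_legendre, ← psi_natCast, hsys]
    congr 2
    push_cast; rfl
  have hre : ∀ f : ℕ → ℂ, ∏ r ∈ Finset.Icc 1 n, f r = ∏ i : Fin n, f ((i : ℕ) + 1) := by
    intro f
    rw [Fin.prod_univ_eq_prod_range (fun i => f (i + 1)), Finset.range_eq_Ico,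
      Finset.prod_Ico_add' f 0 n 1]
    rfl
  rw [hXinv, ← hgs, hre] at hAB1 hAB2
  simp only [← hx] at hAB1 hAB2
  have hd0 := det_zero hp4 hpn A B hAB1 hAB2
  have hG := (dets hp4 hpn).1
  have hLc : ((L : ℝ) : ℂ) = chi p 2 := by
    rw [hL]; have := chi_legendre (p := p) 2; simpa using this.symm
  set a : ℤ → ℝ := fun m => (legendreSym p m : ℝ) with ha
  have hac : ∀ m : ℤ, ((a m : ℝ) : ℂ) = chi p (m : ZMod p) := by
    intro m; rw [chi_legendre]; simp [ha]
  have haneg : ∀ m, a (-m) = a m := by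
    intro m
    have : ((a (-m) : ℝ) : ℂ) = ((a m : ℝ) : ℂ) := by
      rw [hac, hac]; push_cast; exact chi_neg hp4 _
    exact_mod_cast this
  have F0 : (Matrix.of fun j k : Fin n => a ((j : ℤ) - (k : ℤ) + 1)).det = L * (B - A) := by
    have : (((Matrix.of fun j k : Fin n => a ((j : ℤ) - (k : ℤ) + 1)).det : ℝ) : ℂ) =
        ((L * (B - A) : ℝ) : ℂ) := by
      push_cast
      rw [hLc, ← hd0]
      have := (Complex.ofRealHom).map_det (Matrix.of fun j k : Fin n => a ((j : ℤ) - (k : ℤ) + 1))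
      rw [← Complex.ofRealHom_eq_coe, this]
      congr 1
    exact_mod_cast this
  have F1 : (Matrix.of fun j k : Fin n => a ((j : ℤ) - (k : ℤ) + 1) - a ((j : ℤ) - (k : ℤ))).det = L := by
    have : (((Matrix.of fun j k : Fin n => a ((j : ℤ) - (k : ℤ) + 1) - a ((j : ℤ) - (k : ℤ))).det : ℝ) : ℂ) =
        ((L : ℝ) : ℂ) := by
      rw [hLc, ← hG]
      have := (Complex.ofRealHom).map_det (Matrix.of fun j k : Fin n => a ((j : ℤ) - (k : ℤ) + 1) - a ((j : ℤ) - (k : ℤ)))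
      rw [← Complex.ofRealHom_eq_coe, this]
      congr 1
      ext j k
      simp only [RingHom.mapMatrix_apply, Matrix.map_apply, Matrix.of_apply, Complex.ofRealHom_eq_coe,
        Complex.ofReal_sub, hac]
    exact_mod_cast this
  have hL0 : L ≠ 0 := by
    intro h
    rw [h] at hLc
    have := chi_sq (2 : ZMod p) (two_ne_zmod hp4)
    rw [← hLc] at this
    norm_num at this
  obtain ⟨c, hc⟩ := det_affine (Matrix.of fun j k : Fin n => a ((j : ℤ) - (k : ℤ) + 1))
    (by rw [F0]; exact mul_ne_zero hL0 (sub_ne_zero.2 hBA)) (fun k => a (k : ℤ))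
  have h1 := hc (-1)
  have h2 := hc ρ
  have h3 := lower_ones_mul (n := n) a haneg
  have h4 : (Matrix.of fun j k : Fin n => (Matrix.of fun j k : Fin n => a ((j : ℤ) - (k : ℤ) + 1)) j k
      + (-1) * a (k : ℤ)).det = L := by
    rw [← F1, ← h3]
    congr 1
    ext j k
    simp only [Matrix.of_apply]; ring
  rw [h4, F0] at h1
  rw [F0] at h2
  change (Matrix.of fun j k : Fin n => (Matrix.of fun j k : Fin n => a ((j : ℤ) - (k : ℤ) + 1)) j k
      + ρ * a (k : ℤ)).det = _
  rw [h2]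
  linear_combination ρ * h1
end

section
/- Let K be a field, N ≥ 1, and let X_1, …, X_N, Y_1, …, Y_N ∈ K satisfy 1 + X_r·Y_s ≠ 0 for all 1 ≤ r, s ≤ N. Then 2 · (∏_{r,s=1}^N (1 + X_r·Y_s)) · det[(X_r + Y_s)/(1 + X_r·Y_s)]_{1≤r,s≤N} = (∏_{r=1}^N (1 + X_r)(1 + Y_r) + (−1)^N · ∏_{r=1}^N (1 − X_r)(1 − Y_r)) · ∏_{1≤r<s≤N} (X_r − X_s)(Y_s − Y_r). -/
open Matrix BigOperators Finset

theorem aux_affine {K : Type*} [Field K] {N : ℕ} (M : Matrix (Fin N) (Fin N) K) :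
    2 * M.det = (Matrix.of fun r s => M r s + 1).det + (Matrix.of fun r s => M r s - 1).det := by
  let F : K → Matrix (Fin 1 ⊕ Fin N) (Fin 1 ⊕ Fin N) K := fun t =>
    Matrix.fromBlocks 1 (Matrix.of fun _ _ => t) (Matrix.of fun _ _ => 1) M
  have hF : ∀ t, (F t).det = (Matrix.of fun r s => M r s - t).det := by
    intro t
    simp only [F]
    rw [Matrix.det_fromBlocks_one₁₁]
    congr 1
    ext r s
    simp [Matrix.mul_apply]
  have hU : ∀ t, F t = (F 0).updateRow (Sum.inl 0) (Sum.elim (fun _ => 1) (fun _ => t)) := by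
    intro t
    ext i j
    rcases i with i | i
    · have hi : i = 0 := Subsingleton.elim _ _
      subst hi
      rcases j with j | j
      · have hj : j = 0 := Subsingleton.elim _ _
        subst hj
        simp [F]
      · simp [F]
    · rw [Matrix.updateRow_ne (by simp)]
      rcases j with j | j <;> simp [F]
  have h2 : (F 1).det + (F (-1)).det = 2 * (F 0).det := by
    conv_lhs => rw [hU 1, hU (-1)]
    conv_rhs => rw [hU 0]
    rw [← Matrix.det_updateRow_add, ← Matrix.det_updateRow_smul]
    congr 2
    funext j
    rcases j with j | j
    · simp; norm_num
    · simp
  rw [hF, hF, hF] at h2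
  have e : (Matrix.of fun r s => M r s - 0) = M := by ext; simp
  rw [e] at h2
  rw [← h2, add_comm]
  simp

theorem aux_f1 {K : Type*} [Field K] (p q : K) (hp : p ≠ 0) (hq : q ≠ 0) :
    1 / q - p / q * (1 / p) = 0 := by
  field_simp
  ring

theorem aux_f2 {K : Type*} [Field K] (x y z w : K) (h1 : 1 + x * w ≠ 0) (h2 : 1 + z * y ≠ 0)
    (h3 : 1 + z * w ≠ 0) :
    1 / (1 + z * w) - (1 + x * y) / (1 + z * y) * (1 / (1 + x * w)) =
      (x - z) / (1 + z * y) * (1 / (1 + z * w) * ((w - y) / (1 + x * w))) := by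
  have h1' : 1 + w * x ≠ 0 := by rwa [mul_comm w x]
  have h2' : 1 + y * z ≠ 0 := by rwa [mul_comm y z]
  have h3' : 1 + w * z ≠ 0 := by rwa [mul_comm w z]
  field_simp
  ring

theorem aux_cauchy {K : Type*} [Field K] (N : ℕ) : ∀ (X Y : Fin N → K)
    (_ : ∀ r s : Fin N, 1 + X r * Y s ≠ 0),
    (∏ r : Fin N, ∏ s : Fin N, (1 + X r * Y s))
        * (Matrix.of fun r s : Fin N => 1 / (1 + X r * Y s)).det
      = ∏ s : Fin N, ∏ r ∈ Finset.univ.filter (fun r : Fin N => r < s),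
            (X r - X s) * (Y s - Y r) := by
  induction N with
  | zero => intro X Y _; simp
  | succ n ih =>
    intro X Y h
    have ih' := ih (fun i => X i.succ) (fun i => Y i.succ) (fun r s => h _ _)
    let a : Fin n → K := fun i => (X 0 - X i.succ) / (1 + X i.succ * Y 0)
    let b : Fin n → K := fun j => (Y j.succ - Y 0) / (1 + X 0 * Y j.succ)
    let C : Matrix (Fin n) (Fin n) K := Matrix.of fun r s => 1 / (1 + X r.succ * Y s.succ)
    let D : Matrix (Fin n) (Fin n) K := Matrix.of fun r s => a r * (C r s * b s)
    have hD : D.det = (∏ i, a i) * (C.det * ∏ i, b i) := by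
      have : D = Matrix.diagonal a * (C * Matrix.diagonal b) := by
        ext i j
        simp [D]
      rw [this, Matrix.det_mul, Matrix.det_mul, Matrix.det_diagonal, Matrix.det_diagonal]
    let c : Fin (n+1) → K := Fin.cons 0 (fun i => (1 + X 0 * Y 0) / (1 + X i.succ * Y 0))
    let B : Matrix (Fin (n+1)) (Fin (n+1)) K := Matrix.of fun r s =>
      1 / (1 + X r * Y s) - c r * (1 / (1 + X 0 * Y s))
    have hB : (Matrix.of fun r s : Fin (n+1) => 1 / (1 + X r * Y s)).det = B.det := by
      refine Matrix.det_eq_of_forall_row_eq_smul_add_const c 0 (by simp [c]) ?_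
      intro i j
      simp [B, c]
    have hB0 : ∀ i : Fin n, B i.succ 0 = 0 := by
      intro i
      have h1 := h 0 0
      have h2 := h i.succ 0
      simp only [B, c, Matrix.of_apply, Fin.cons_succ]
      exact aux_f1 _ _ h1 h2
    have hBD : B.submatrix (Fin.succAbove 0) Fin.succ = D := by
      ext i j
      have h1 := h 0 j.succ
      have h2 := h i.succ 0
      have h3 := h i.succ j.succ
      simp only [B, c, D, C, a, b, Matrix.of_apply, Fin.cons_succ, Matrix.submatrix_apply,
        Fin.zero_succAbove]
      exact aux_f2 _ _ _ _ h1 h2 h3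
    have hB00 : B 0 0 = 1 / (1 + X 0 * Y 0) := by simp [B, c]
    have hdet : B.det = 1 / (1 + X 0 * Y 0) * D.det := by
      rw [Matrix.det_succ_column_zero, Fin.sum_univ_succ, hBD, hB00]
      simp [hB0]
    rw [hB, hdet, hD]
    have hC : C.det = (Matrix.of fun r s : Fin n => 1 / (1 + X r.succ * Y s.succ)).det := rfl
    rw [← hC] at ih'
    simp only [Finset.prod_filter] at ih' ⊢
    simp only [Fin.prod_univ_succ, Fin.succ_lt_succ_iff, Fin.succ_pos, Fin.not_lt_zero, if_true,
      if_false, Finset.prod_const_one, Finset.prod_mul_distrib, one_mul, lt_irrefl]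
    rw [← ih']
    simp only [a, b, Finset.prod_div_distrib]
    have h1 := h 0 0
    have h2 : (∏ i : Fin n, (1 + X i.succ * Y 0)) ≠ 0 :=
      Finset.prod_ne_zero_iff.2 fun i _ => h _ _
    have h3 : (∏ i : Fin n, (1 + X 0 * Y i.succ)) ≠ 0 :=
      Finset.prod_ne_zero_iff.2 fun i _ => h _ _
    generalize (∏ i : Fin n, (1 + X i.succ * Y 0)) = P at h2 ⊢
    generalize (∏ i : Fin n, (1 + X 0 * Y i.succ)) = Q at h3 ⊢
    generalize 1 + X 0 * Y 0 = R at h1 ⊢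
    field_simp

/-- The Cauchy-type determinant evaluation
`det[(X_r + Y_s)/(1 + X_r Y_s)]`, in cleared-denominator form. -/
theorem stmt_7 (K : Type*) [Field K] (N : ℕ) (hN : 1 ≤ N)
    (X Y : Fin N → K) (h : ∀ r s : Fin N, 1 + X r * Y s ≠ 0) :
    2 * (∏ r : Fin N, ∏ s : Fin N, (1 + X r * Y s))
        * (Matrix.of fun r s : Fin N => (X r + Y s) / (1 + X r * Y s)).det
      = ((∏ r : Fin N, (1 + X r) * (1 + Y r))
          + (-1 : K) ^ N * ∏ r : Fin N, (1 - X r) * (1 - Y r))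
        * ∏ s : Fin N, ∏ r ∈ Finset.univ.filter (fun r : Fin N => r < s),
            (X r - X s) * (Y s - Y r) := by
  rw [mul_right_comm, aux_affine]
  have hc := aux_cauchy N X Y h
  have e1 : (Matrix.of fun r s : Fin N =>
      (Matrix.of fun r s : Fin N => (X r + Y s) / (1 + X r * Y s)) r s + 1)
      = Matrix.diagonal (fun r => 1 + X r) * ((Matrix.of fun r s : Fin N => 1 / (1 + X r * Y s))
        * Matrix.diagonal (fun r => 1 + Y r)) := by
    ext i j
    have := h i j
    simp only [Matrix.diagonal_mul, Matrix.mul_diagonal, Matrix.of_apply]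
    field_simp
    ring
  have e2 : (Matrix.of fun r s : Fin N =>
      (Matrix.of fun r s : Fin N => (X r + Y s) / (1 + X r * Y s)) r s - 1)
      = -(Matrix.diagonal (fun r => 1 - X r) * ((Matrix.of fun r s : Fin N => 1 / (1 + X r * Y s))
        * Matrix.diagonal (fun r => 1 - Y r))) := by
    ext i j
    have := h i j
    simp only [Matrix.neg_apply, Matrix.diagonal_mul, Matrix.mul_diagonal, Matrix.of_apply]
    field_simp
    ring
  rw [e1, e2, Matrix.det_neg, Fintype.card_fin]
  simp only [Matrix.det_mul, Matrix.det_diagonal]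
  rw [← hc, Finset.prod_mul_distrib (f := fun r => 1 + X r),
    Finset.prod_mul_distrib (f := fun r => 1 - X r)]
  ring
end

section
/- Let p be a prime with p ≡ 1 (mod 4) and n = (p−1)/2. Set x_r = χ(r)·ζ^{−r} for 1 ≤ r ≤ n, and define X_0 = 0, X_r = x_r (1 ≤ r ≤ n). Then 1 + X_r·X_s ≠ 0 for all 0 ≤ r, s ≤ n, and the determinant J = det[(X_r + X_s)/(1 + X_r·X_s)]_{0≤r,s≤n} of this (n+1)×(n+1) complex matrix equals (−1)^{(p−1)/4} · (1/2) · (∏_{r=1}^n (1 + x_r)² − ∏_{r=1}^n (1 − x_r)²) · ∏_{1≤r<s≤n} (x_r − x_s)² · (∏_{r,s=1}^n (1 + x_r·x_s))^{−1} · ∏_{r=1}^n x_r². -/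
open Complex Matrix BigOperators Finset

/-- The determinant is affine along the all-ones direction. -/
lemma det_affine_aux {m : ℕ} (A : Matrix (Fin m) (Fin m) ℂ) :
    ∃ a d : ℂ, ∀ t : ℂ, (Matrix.of fun i j => A i j + t).det = a + t * d := by
  let N : Matrix (Unit ⊕ Fin m) (Unit ⊕ Fin m) ℂ :=
    Matrix.fromBlocks 1 (Matrix.of fun _ _ => 1) 0 A
  let u : Unit ⊕ Fin m → ℂ := Sum.elim (fun _ => 1) (fun _ => 0)
  let v : Unit ⊕ Fin m → ℂ := Sum.elim (fun _ => 0) (fun _ => -1)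
  refine ⟨(N.updateCol (Sum.inl ()) u).det, (N.updateCol (Sum.inl ()) v).det, fun t => ?_⟩
  rw [← Matrix.det_updateCol_smul, ← Matrix.det_updateCol_add]
  have h : N.updateCol (Sum.inl ()) (u + t • v) =
      Matrix.fromBlocks 1 (Matrix.of fun _ _ => 1) (Matrix.of fun _ _ => -t) A := by
    ext i j
    rcases i with i | i <;> rcases j with j | j <;> simp [N, u, v]
  rw [h, Matrix.det_fromBlocks_one₁₁]
  congr 1
  ext i j
  simp [Matrix.mul_apply]

lemma det_tanh_aux {m : ℕ} (f : Fin m → ℂ) (h : ∀ i j, 1 + f i * f j ≠ 0) :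
    (Matrix.of fun i j => (f i + f j) / (1 + f i * f j)).det =
      1 / 2 * ((∏ i, (1 + f i) ^ 2) + (-1) ^ m * ∏ i, (1 - f i) ^ 2) *
        (Matrix.of fun i j => (1 + f i * f j)⁻¹).det := by
  obtain ⟨a, d, had⟩ := det_affine_aux
    (Matrix.of fun i j => (1 + f i) * (1 + f j) * (1 + f i * f j)⁻¹)
  have scale : ∀ u v : Fin m → ℂ, (Matrix.of fun i j => u i * v j * (1 + f i * f j)⁻¹).det =
      (∏ i, u i) * (∏ i, v i) * (Matrix.of fun i j => (1 + f i * f j)⁻¹).det := by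
    intro u v
    rw [mul_assoc, ← Matrix.det_mul_row, ← Matrix.det_mul_column]
    congr 1
    ext i j
    simp [mul_assoc]
  have h0 := had 0
  have h1 := had (-1)
  have h2 := had (-2)
  have e0 : (Matrix.of fun i j => (Matrix.of fun i j => (1 + f i) * (1 + f j) *
      (1 + f i * f j)⁻¹) i j + 0) =
      (Matrix.of fun i j => (1 + f i) * (1 + f j) * (1 + f i * f j)⁻¹) := by
    ext i j; simp
  have e1 : (Matrix.of fun i j => (Matrix.of fun i j => (1 + f i) * (1 + f j) *
      (1 + f i * f j)⁻¹) i j + (-1)) =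
      (Matrix.of fun i j => (f i + f j) / (1 + f i * f j)) := by
    ext i j
    have := h i j
    simp only [Matrix.of_apply]
    field_simp
    ring
  have e2 : (Matrix.of fun i j => (Matrix.of fun i j => (1 + f i) * (1 + f j) *
      (1 + f i * f j)⁻¹) i j + (-2)) =
      (Matrix.of fun i j => (-1 * (1 - f i)) * (1 - f j) * (1 + f i * f j)⁻¹) := by
    ext i j
    have := h i j
    simp only [Matrix.of_apply]
    field_simp
    ring
  rw [e0, scale] at h0
  rw [e1] at h1
  rw [e2, scale, Finset.prod_mul_distrib] at h2
  simp only [Finset.prod_const, Finset.card_univ, Fintype.card_fin] at h2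
  rw [h1, Finset.prod_pow, Finset.prod_pow]
  linear_combination (-1 / 2) * h0 - (1 / 2) * h2

lemma det_cauchy_step (f : ℕ → ℂ) (m : ℕ)
    (h : ∀ i j, i ≤ m → j ≤ m → 1 + f i * f j ≠ 0) :
    (Matrix.of fun i j : Fin (m + 1) => (1 + f i * f j)⁻¹).det =
      (1 + f m * f m)⁻¹ * (∏ r ∈ Finset.range m, (-(f r - f m) ^ 2 / (1 + f r * f m) ^ 2)) *
      (Matrix.of fun i j : Fin m => (1 + f i * f j)⁻¹).det := by
  let B : Matrix (Fin (m + 1)) (Fin (m + 1)) ℂ := Matrix.of fun i j => (1 + f i * f j)⁻¹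
  let c : Fin (m + 1) → ℂ := fun i =>
    if i = Fin.last m then 0 else -((1 + f m * f m) / (1 + f i * f m))
  have key : (Matrix.of fun i j => B i j + c i * B (Fin.last m) j).det = B.det :=
    Matrix.det_eq_of_forall_row_eq_smul_add_const c (Fin.last m) (by simp [c]) (fun i j => rfl)
  change B.det = _
  rw [← key, Matrix.det_succ_column _ (Fin.last m), Fin.sum_univ_castSucc]
  have hz : ∀ i : Fin m, B i.castSucc (Fin.last m) + c i.castSucc * B (Fin.last m) (Fin.last m)
      = 0 := by
    intro i
    have h1 := h i m i.2.le le_rfl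
    have h2 := h m m le_rfl le_rfl
    have h3 : i.castSucc ≠ Fin.last m := (Fin.castSucc_lt_last i).ne
    simp only [B, c, h3, if_false, Matrix.of_apply, Fin.val_castSucc, Fin.val_last]
    rw [neg_mul, div_mul_eq_mul_div, mul_inv_cancel₀ h2, one_div, add_neg_cancel]
  simp only [Matrix.of_apply, hz, mul_zero, zero_mul, Finset.sum_const_zero, zero_add]
  have hs : (-1 : ℂ) ^ ((Fin.last m : ℕ) + (Fin.last m : ℕ)) = 1 := by
    rw [← two_mul, pow_mul]; simp
  have hc : c (Fin.last m) = 0 := by simp [c]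
  rw [hs, hc, one_mul, zero_mul, add_zero, mul_assoc]
  have hB : B (Fin.last m) (Fin.last m) = (1 + f m * f m)⁻¹ := by simp [B]
  rw [hB]
  congr 1
  have hsub : (Matrix.of fun i j => B i j + c i * B (Fin.last m) j).submatrix
      (Fin.last m).succAbove (Fin.last m).succAbove =
      Matrix.of fun i j : Fin m => (-(f i - f m) / (1 + f i * f m)) *
        ((Matrix.of fun i j : Fin m => ((f j - f m) / (1 + f j * f m)) *
          (Matrix.of fun i j : Fin m => (1 + f i * f j)⁻¹) i j) i j) := by
    ext i j
    have h1 := h i m i.2.le le_rfl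
    have h2 := h j m j.2.le le_rfl
    have h3 := h i j i.2.le j.2.le
    have h4 : 1 + f m * f j ≠ 0 := by rw [mul_comm]; exact h2
    have h5 : i.castSucc ≠ Fin.last m := (Fin.castSucc_lt_last i).ne
    simp only [B, c, Matrix.submatrix_apply, Fin.succAbove_last, h5, if_false, Matrix.of_apply,
      Fin.val_castSucc, Fin.val_last]
    field_simp
    ring
  rw [hsub, Matrix.det_mul_column, Matrix.det_mul_row, ← mul_assoc, ← Finset.prod_mul_distrib,
    Finset.prod_range]
  congr 1
  refine Finset.prod_congr rfl fun i _ => ?_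
  rw [div_mul_div_comm]
  congr 1 <;> ring

lemma det_cauchy_aux (f : ℕ → ℂ) (f0 : f 0 = 0) (n : ℕ)
    (h : ∀ i j, i ≤ n → j ≤ n → 1 + f i * f j ≠ 0) :
    (Matrix.of fun i j : Fin (n + 1) => (1 + f i * f j)⁻¹).det =
      (∏ s ∈ Finset.Icc 1 n, (-1 : ℂ) ^ s)
        * (∏ s ∈ Finset.Icc 1 n, ∏ r ∈ Finset.Ico 1 s, (f r - f s) ^ 2)
        * (∏ r ∈ Finset.Icc 1 n, ∏ s ∈ Finset.Icc 1 n, (1 + f r * f s))⁻¹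
        * ∏ r ∈ Finset.Icc 1 n, (f r) ^ 2 := by
  induction n with
  | zero => simp [f0]
  | succ n ih =>
    have ih := ih fun i j hi hj => h i j (by omega) (by omega)
    rw [det_cauchy_step f (n + 1) h, ih]
    have e : Finset.Ico 1 (n + 1) = Finset.Icc 1 n := by ext; simp
    simp only [Finset.prod_Icc_succ_top (show 1 ≤ n + 1 by omega), Finset.prod_mul_distrib]
    rw [Finset.range_eq_Ico, Finset.prod_eq_prod_Ico_succ_bot (by omega : 0 < n + 1), f0, zero_add,
      e]
    have e2 : ∏ s ∈ Finset.Icc 1 n, (1 + f (n + 1) * f s) =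
        ∏ s ∈ Finset.Icc 1 n, (1 + f s * f (n + 1)) :=
      Finset.prod_congr rfl fun s _ => by ring
    have e3 : ∏ r ∈ Finset.Icc 1 n, (-(f r - f (n + 1)) ^ 2 / (1 + f r * f (n + 1)) ^ 2) =
        (-1) ^ n * (∏ r ∈ Finset.Icc 1 n, (f r - f (n + 1)) ^ 2) *
        ((∏ r ∈ Finset.Icc 1 n, (1 + f r * f (n + 1))) ^ 2)⁻¹ := by
      rw [Finset.prod_div_distrib, Finset.prod_neg, Finset.prod_pow _ 2 (fun r => 1 + _)]
      simp [div_eq_mul_inv]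
    rw [e2, e3]
    simp only [mul_inv, pow_succ, pow_zero]
    ring

lemma sign_aux (k : ℕ) : (∏ s ∈ Finset.Icc 1 (2 * k), (-1 : ℂ) ^ s) = (-1) ^ k := by
  induction k with
  | zero => simp
  | succ k ih =>
    rw [show 2 * (k + 1) = 2 * k + 1 + 1 by ring, Finset.prod_Icc_succ_top (by omega),
      Finset.prod_Icc_succ_top (by omega), ih]
    simp [pow_succ, pow_mul]

/-- Evaluation of the diagonal Cauchy determinant `J`
with nodes `X₀ = 0, X_r = x_r = χ(r)ζ^{-r}`. -/
theorem stmt_9 (p : ℕ) [Fact p.Prime] (hp4 : p % 4 = 1)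
    (n : ℕ) (hn : n = (p - 1) / 2)
    (ζ : ℂ) (hζ : ζ = Complex.exp (2 * Real.pi * Complex.I / p))
    (x : ℕ → ℂ)
    (hx : ∀ r : ℕ, x r = (legendreSym p (r : ℤ) : ℂ) * ζ ^ (-(r : ℤ)))
    (X : Fin (n + 1) → ℂ)
    (hX : ∀ i : Fin (n + 1), X i = if (i : ℕ) = 0 then 0 else x (i : ℕ)) :
    (∀ r s : Fin (n + 1), 1 + X r * X s ≠ 0) ∧
    (Matrix.of fun r s : Fin (n + 1) => (X r + X s) / (1 + X r * X s)).det
      = (-1 : ℂ) ^ ((p - 1) / 4) * (1 / 2)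
        * ((∏ r ∈ Finset.Icc 1 n, (1 + x r) ^ 2) - ∏ r ∈ Finset.Icc 1 n, (1 - x r) ^ 2)
        * (∏ s ∈ Finset.Icc 1 n, ∏ r ∈ Finset.Ico 1 s, (x r - x s) ^ 2)
        * (∏ r ∈ Finset.Icc 1 n, ∏ s ∈ Finset.Icc 1 n, (1 + x r * x s))⁻¹
        * ∏ r ∈ Finset.Icc 1 n, (x r) ^ 2 := by
  have hpp : p.Prime := Fact.out
  have hprim : IsPrimitiveRoot ζ p := by
    rw [hζ]; exact Complex.isPrimitiveRoot_exp p hpp.ne_zero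
  have x0 : x 0 = 0 := by rw [hx]; simp
  have hXx : ∀ i : Fin (n + 1), X i = x i := by
    intro i
    rw [hX]
    split_ifs with h
    · rw [h, x0]
    · rfl
  have hζ0 : ζ ≠ 0 := hprim.ne_zero hpp.ne_zero
  have hne : ∀ i j, i ≤ n → j ≤ n → 1 + x i * x j ≠ 0 := by
    intro i j hi hj hij
    rcases Nat.eq_zero_or_pos i with rfl | hi0
    · simp [x0] at hij
    rcases Nat.eq_zero_or_pos j with rfl | hj0
    · simp [x0] at hij
    have hL : ∀ r : ℕ, 0 < r → r ≤ n → (x r * ζ ^ r) ^ 2 = 1 := by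
      intro r hr hrn
      have hr' : ((r : ℤ) : ZMod p) ≠ 0 := by
        rw [Int.cast_natCast, Ne, ZMod.natCast_eq_zero_iff]
        intro hd
        have := Nat.le_of_dvd hr hd
        omega
      have hsq := legendreSym.sq_one p hr'
      rw [hx, _root_.zpow_neg, _root_.zpow_natCast, mul_assoc, inv_mul_cancel₀ (pow_ne_zero _ hζ0), mul_one]
      exact_mod_cast hsq
    have h1 := hL i hi0 hi
    have h2 := hL j hj0 hj
    have h3 : x i * x j = -1 := by linear_combination hij
    have h4 : ζ ^ (2 * (i + j)) = 1 := by
      have : (x i * x j) ^ 2 * ζ ^ (2 * (i + j)) = 1 := by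
        calc _ = (x i * ζ ^ i) ^ 2 * (x j * ζ ^ j) ^ 2 := by ring
          _ = 1 := by rw [h1, h2, one_mul]
      rw [h3] at this
      simpa using this
    have h5 := hprim.dvd_of_pow_eq_one _ h4
    rcases (Nat.Prime.dvd_mul hpp).1 h5 with h6 | h6
    · have := Nat.le_of_dvd (by norm_num) h6
      have := hpp.two_le
      omega
    · have := Nat.le_of_dvd (by omega) h6
      have := hpp.two_le
      omega
  have hneX : ∀ r s : Fin (n + 1), 1 + X r * X s ≠ 0 := by
    intro r s
    rw [hXx, hXx]
    exact hne r s (by omega) (by omega)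
  refine ⟨hneX, ?_⟩
  rw [det_tanh_aux X hneX]
  simp only [hXx]
  rw [det_cauchy_aux x x0 n hne]
  obtain ⟨k, hk⟩ : ∃ k, p = 4 * k + 1 := ⟨p / 4, by omega⟩
  have hn2 : n = 2 * k := by omega
  have hk4 : (p - 1) / 4 = k := by omega
  have hprod : ∀ g : ℕ → ℂ, g 0 = 1 → ∏ i : Fin (n + 1), g i = ∏ r ∈ Finset.Icc 1 n, g r := by
    intro g hg
    rw [← Finset.prod_range, Finset.range_eq_Ico,
      Finset.prod_eq_prod_Ico_succ_bot (by omega : 0 < n + 1), hg, one_mul]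
    congr 1
  rw [hprod (fun i => (1 + x i) ^ 2) (by simp [x0]), hprod (fun i => (1 - x i) ^ 2) (by simp [x0])]
  have hs1 : (-1 : ℂ) ^ (n + 1) = -1 := by rw [hn2, pow_succ, pow_mul]; simp
  have hs2 : (∏ s ∈ Finset.Icc 1 n, (-1 : ℂ) ^ s) = (-1) ^ k := by rw [hn2, sign_aux]
  rw [hs1, hs2, hk4]
  ring
end
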